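/- Let M_p be a weight sequence satisfying (M.1), (M.2)' and (M.3)', and let ω : ℝ^d → (0,∞) be measurable with: for every R > 0 there is C_R > 0 such that ω(x+h) ≤ C_R ω(x) for all x ∈ ℝ^d and |h| ≤ R. For a Beurling ultradistribution f of class (M_p) on ℝ^d the following are equivalent: (i) there exist ℓ > 0 and C > 0 such that |⟨f,φ⟩| ≤ C ‖φ‖_{D^{M_p,ℓ}_{L¹_ω}} for all φ ∈ D^{(M_p)}(ℝ^d); (ii) there exist continuous functions f_α : ℝ^d → ℂ (α ∈ ℕ^d), some ℓ > 0 and C > 0 with |f_α(x)| ≤ C (ℓ^{|α|}/M_α) ω(x) for all x ∈ ℝ^d and α ∈ ℕ^d, such that ⟨f,φ⟩ = Σ_{α∈ℕ^d} (−1)^{|α|} ∫ f_α(x) ∂^αφ(x) dx (absolutely convergent) for every φ ∈ D^{(M_p)}(ℝ^d); (iii) for every φ ∈ D^{(M_p)}(ℝ^d), sup_{h∈ℝ^d} |⟨f, φ(·−h)⟩|/ω(h) < ∞. -/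

import Mathlib

open MeasureTheory Real
open scoped BigOperators Pointwise

noncomputable section

/-- `ℝ^d` with the Euclidean norm. -/
abbrev Rd (d : ℕ) := EuclideanSpace ℝ (Fin d)

/-- Condition (M.1): a positive, logarithmically convex weight sequence. -/
def IsM1 (M : ℕ → ℝ) : Prop :=
  (∀ p, 0 < M p) ∧ ∀ p : ℕ, 1 ≤ p → (M p) ^ 2 ≤ M (p - 1) * M (p + 1)

/-- Condition (M.2)'. -/
def IsM2' (M : ℕ → ℝ) : Prop :=
  ∃ A H : ℝ, 1 ≤ A ∧ 1 ≤ H ∧ ∀ p : ℕ, M (p + 1) ≤ A * H ^ p * M p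

/-- Condition (M.2). -/
def IsM2 (M : ℕ → ℝ) : Prop :=
  ∃ A H : ℝ, 1 ≤ A ∧ 1 ≤ H ∧ ∀ p q : ℕ, M (p + q) ≤ A * H ^ (p + q) * M p * M q

/-- Condition (M.3)'. -/
def IsM3' (M : ℕ → ℝ) : Prop := Summable fun p : ℕ => M p / M (p + 1)

/-- Condition (M.3). -/
def IsM3 (M : ℕ → ℝ) : Prop :=
  IsM3' M ∧ ∃ c₀ > (0 : ℝ), ∀ q : ℕ, 1 ≤ q →
    (∑' j : ℕ, M (q + j - 1) / M (q + j)) ≤ c₀ * q * (M (q - 1) / M q)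

/-- The associated function `M(t) = sup_p log (t^p M 0 / M p)`, with `M(0) = 0`. -/
def assocFn (M : ℕ → ℝ) (t : ℝ) : ℝ :=
  if t = 0 then 0 else ⨆ p : ℕ, Real.log (t ^ p * M 0 / M p)

variable {d : ℕ}

/-- The partial derivative in the `i`-th coordinate direction. -/
def pder (i : Fin d) (f : Rd d → ℂ) : Rd d → ℂ :=
  fun x => fderiv ℝ f x (EuclideanSpace.single i 1)

/-- The multi-index partial derivative `∂^α`. -/
def mderiv (α : Fin d → ℕ) (f : Rd d → ℂ) : Rd d → ℂ :=
  (List.finRange d).foldr (fun i g => (pder i)^[α i] g) f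

/-- The order `|α|` of a multi-index. -/
def mOrd (α : Fin d → ℕ) : ℕ := ∑ i, α i

/-- The factorial `α!` of a multi-index. -/
def mFact (α : Fin d → ℕ) : ℕ := ∏ i, Nat.factorial (α i)

/-- The set of quotients defining the norm of `E^{M_p,ℓ}(K)`. -/
def ESet (M : ℕ → ℝ) (ℓ : ℝ) (K : Set (Rd d)) (φ : Rd d → ℂ) : Set ℝ :=
  {r | ∃ (α : Fin d → ℕ) (x : Rd d), x ∈ K ∧
    r = ‖mderiv α φ x‖ / (ℓ ^ mOrd α * M (mOrd α))}

/-- `‖φ‖_{E^{M_p,ℓ}(K)}`. -/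
def Enorm (M : ℕ → ℝ) (ℓ : ℝ) (K : Set (Rd d)) (φ : Rd d → ℂ) : ℝ :=
  sSup (ESet M ℓ K φ)

/-- Finiteness of `‖φ‖_{E^{M_p,ℓ}(K)}`. -/
def EnormFin (M : ℕ → ℝ) (ℓ : ℝ) (K : Set (Rd d)) (φ : Rd d → ℂ) : Prop :=
  BddAbove (ESet M ℓ K φ)

/-- Membership in the test space `D^{(M_p)}(ℝ^d)`. -/
def IsTestD (M : ℕ → ℝ) (φ : Rd d → ℂ) : Prop :=
  ContDiff ℝ (⊤ : ℕ∞) φ ∧ HasCompactSupport φ ∧ ∀ ℓ > (0 : ℝ), EnormFin M ℓ (tsupport φ) φ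

/-- `f` is a Beurling ultradistribution of class `(M_p)`. -/
def IsUltraD (M : ℕ → ℝ) (f : (Rd d → ℂ) →ₗ[ℂ] ℂ) : Prop :=
  ∀ K : Set (Rd d), IsCompact K → ∃ ℓ > (0 : ℝ), ∃ C > (0 : ℝ), ∀ φ : Rd d → ℂ,
    IsTestD M φ → tsupport φ ⊆ K → ‖f φ‖ ≤ C * Enorm M ℓ K φ

/-- Euclidean dot product. -/
def dotR (ξ t : Rd d) : ℝ := ∑ i, ξ i * t i

/-- The window `t ↦ conj(ψ(t-x)) e^{-2πi ξ·t}` of the short-time Fourier transform. -/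
def windowFn (ψ : Rd d → ℂ) (x ξ : Rd d) : Rd d → ℂ :=
  fun t => (starRingEnd ℂ) (ψ (t - x)) * Complex.exp (-(2 * Real.pi * dotR ξ t : ℝ) * Complex.I)

/-- The short-time Fourier transform of a function `φ` with respect to the window `ψ`. -/
def STFTf (ψ φ : Rd d → ℂ) (x ξ : Rd d) : ℂ := ∫ t, φ t * windowFn ψ x ξ t

/-- The short-time Fourier transform of a linear functional `f` w.r.t. the window `ψ`. -/
def STFTd (f : (Rd d → ℂ) →ₗ[ℂ] ℂ) (ψ : Rd d → ℂ) (x ξ : Rd d) : ℂ := f (windowFn ψ x ξ)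

/-- The weight condition (5): `ω(·+x)/ω(x)` locally uniformly bounded. -/
def OmegaCond (ω : Rd d → ℝ) : Prop :=
  (∀ x, 0 < ω x) ∧ Measurable ω ∧
    ∀ R > (0 : ℝ), ∃ C > (0 : ℝ), ∀ x h : Rd d, ‖h‖ ≤ R → ω (x + h) ≤ C * ω x

/-- The set of values defining `‖φ‖_{D^{M_p,ℓ}_{L¹_ω}}`. -/
def DL1Set (M : ℕ → ℝ) {d : ℕ} (ω : Rd d → ℝ) (ℓ : ℝ) (φ : Rd d → ℂ) : Set ℝ :=
  {r | ∃ α : Fin d → ℕ, r = (∫ x, ‖mderiv α φ x‖ * ω x) / (ℓ ^ mOrd α * M (mOrd α))}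

/-- `‖φ‖_{D^{M_p,ℓ}_{L¹_ω}}`. -/
def DL1norm (M : ℕ → ℝ) {d : ℕ} (ω : Rd d → ℝ) (ℓ : ℝ) (φ : Rd d → ℂ) : ℝ :=
  sSup (DL1Set M ω ℓ φ)

/-- Finiteness of `‖φ‖_{D^{M_p,ℓ}_{L¹_ω}}`. -/
def DL1Fin (M : ℕ → ℝ) {d : ℕ} (ω : Rd d → ℝ) (ℓ : ℝ) (φ : Rd d → ℂ) : Prop :=
  (∀ α : Fin d → ℕ, Integrable fun x => ‖mderiv α φ x‖ * ω x) ∧ BddAbove (DL1Set M ω ℓ φ)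

/-- Smoothness of complex functions on `ℝ^d`. -/
abbrev Smooth (f : Rd d → ℂ) : Prop := ContDiff ℝ (⊤ : ℕ∞) f

/-- The iterated partial derivative along a word of coordinate directions. -/
def wder (w : List (Fin d)) (f : Rd d → ℂ) : Rd d → ℂ := w.foldr pder f

@[simp] lemma wder_nil (f : Rd d → ℂ) : wder [] f = f := rfl

@[simp] lemma wder_cons (i : Fin d) (w : List (Fin d)) (f : Rd d → ℂ) :
    wder (i :: w) f = pder i (wder w f) := rfl

lemma wder_append (w v : List (Fin d)) (f : Rd d → ℂ) : wder (w ++ v) f = wder w (wder v f) := by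
  simp [wder, List.foldr_append]

lemma wder_replicate (n : ℕ) (i : Fin d) (f : Rd d → ℂ) :
    wder (List.replicate n i) f = (pder i)^[n] f := by
  induction n with
  | zero => rfl
  | succ n ih => rw [List.replicate_succ, wder_cons, ih, Function.iterate_succ_apply']

lemma Smooth.differentiable {f : Rd d → ℂ} (hf : Smooth f) : Differentiable ℝ f :=
  ContDiff.differentiable hf (by simp)

lemma Smooth.pder {f : Rd d → ℂ} (hf : Smooth f) (i : Fin d) : Smooth (pder i f) :=
  (ContDiff.fderiv_right (m := (⊤ : ℕ∞)) hf (by simp)).clm_apply contDiff_const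

lemma Smooth.wder {f : Rd d → ℂ} (hf : Smooth f) (w : List (Fin d)) : Smooth (wder w f) := by
  induction w with
  | nil => exact hf
  | cons i w ih => exact ih.pder i

lemma pder_comm {f : Rd d → ℂ} (hf : Smooth f) (i j : Fin d) :
    pder i (pder j f) = pder j (pder i f) := by
  have hd : Differentiable ℝ (fderiv ℝ f) :=
    (ContDiff.fderiv_right (m := (⊤ : ℕ∞)) hf (by simp)).differentiable (by simp)
  have key : ∀ (a b : Fin d) (x : Rd d), pder a (pder b f) x =
      fderiv ℝ (fderiv ℝ f) x (EuclideanSpace.single a 1) (EuclideanSpace.single b 1) := by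
    intro a b x
    have : HasFDerivAt (pder b f) (((fderiv ℝ (fderiv ℝ f) x).flip
        (EuclideanSpace.single b 1))) x := by
      have h1 := (hd x).hasFDerivAt.clm_apply (hasFDerivAt_const (EuclideanSpace.single b (1 : ℝ)) x)
      simpa using! h1
    unfold pder at this ⊢
    rw [this.fderiv]; rfl
  ext x
  rw [key, key]
  have hs : IsSymmSndFDerivAt ℝ f x := (hf.contDiffAt).isSymmSndFDerivAt
    (by
      rw [minSmoothness_of_isRCLikeNormedField]
      exact WithTop.coe_le_coe.2 (le_top : (2 : ℕ∞) ≤ ⊤))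
  exact hs _ _

lemma wder_perm {f : Rd d → ℂ} (hf : Smooth f) {w v : List (Fin d)} (h : w.Perm v) :
    wder w f = wder v f := by
  induction h with
  | nil => rfl
  | cons i _ ih => simp [ih]
  | swap i j l => simp [pder_comm (hf.wder l)]
  | trans _ _ h1 h2 => rw [h1, h2]

/-- The word listing the coordinate directions of a multi-index. -/
def mword (α : Fin d → ℕ) : List (Fin d) :=
  (List.finRange d).flatMap fun i => List.replicate (α i) i

lemma mderiv_eq_wder (α : Fin d → ℕ) (f : Rd d → ℂ) : mderiv α f = wder (mword α) f := by
  unfold mderiv mword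
  induction List.finRange d with
  | nil => rfl
  | cons i l ih => rw [List.foldr_cons, List.flatMap_cons, wder_append, ih, wder_replicate]

lemma length_mword (α : Fin d → ℕ) : (mword α).length = mOrd α := by
  simp [mword, mOrd, List.length_flatMap, List.finRange_eq_pmap_range, Fin.sum_univ_def]

lemma count_mword (α : Fin d → ℕ) (i : Fin d) : (mword α).count i = α i := by
  unfold mword
  rw [List.count_flatMap]
  have : (List.count i ∘ fun j => List.replicate (α j) j) = fun j => if i = j then α i else 0 := by
    ext j
    by_cases h : i = j
    · subst h; simp
    · simp [List.count_replicate, h, Ne.symm h]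
  rw [this, ← Fin.sum_univ_def]
  simp

lemma wder_eq_mderiv {f : Rd d → ℂ} (hf : Smooth f) (w : List (Fin d)) :
    wder w f = mderiv (fun i => w.count i) f := by
  rw [mderiv_eq_wder]
  apply wder_perm hf
  rw [List.perm_iff_count]
  intro i
  rw [count_mword]

lemma mOrd_count (w : List (Fin d)) : mOrd (fun i => w.count i) = w.length := by
  rw [← length_mword]
  apply List.Perm.length_eq
  rw [List.perm_iff_count]
  intro i
  rw [count_mword]

lemma pder_add {f g : Rd d → ℂ} (hf : Smooth f) (hg : Smooth g) (i : Fin d) :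
    pder i (fun x => f x + g x) = fun x => pder i f x + pder i g x := by
  ext x
  simp only [pder]
  rw [fderiv_fun_add (hf.differentiable x) (hg.differentiable x)]; rfl

lemma pder_mul {f g : Rd d → ℂ} (hf : Smooth f) (hg : Smooth g) (i : Fin d) :
    pder i (fun x => f x * g x) = fun x => f x * pder i g x + pder i f x * g x := by
  ext x
  simp only [pder]
  rw [fderiv_fun_mul (hf.differentiable x) (hg.differentiable x)]
  simp [mul_comm]

lemma pder_const_mul (c : ℂ) {f : Rd d → ℂ} (hf : Smooth f) (i : Fin d) :
    pder i (fun x => c * f x) = fun x => c * pder i f x := by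
  ext x
  simp only [pder]
  rw [fderiv_const_mul (hf.differentiable x)]; rfl

lemma wder_add {f g : Rd d → ℂ} (hf : Smooth f) (hg : Smooth g) (w : List (Fin d)) :
    wder w (fun x => f x + g x) = fun x => wder w f x + wder w g x := by
  induction w with
  | nil => rfl
  | cons i w ih => rw [wder_cons, ih, pder_add (hf.wder w) (hg.wder w)]; rfl

lemma wder_const_mul (c : ℂ) {f : Rd d → ℂ} (hf : Smooth f) (w : List (Fin d)) :
    wder w (fun x => c * f x) = fun x => c * wder w f x := by
  induction w with
  | nil => rfl
  | cons i w ih => rw [wder_cons, ih, pder_const_mul c (hf.wder w)]; rfl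

lemma wder_sub {f g : Rd d → ℂ} (hf : Smooth f) (hg : Smooth g) (w : List (Fin d)) :
    wder w (fun x => f x - g x) = fun x => wder w f x - wder w g x := by
  have h : Smooth (fun x => (-1 : ℂ) * g x) := contDiff_const.mul hg
  have := wder_add hf h w
  rw [wder_const_mul (-1) hg] at this
  simpa [← sub_eq_add_neg] using this

lemma wder_zero (w : List (Fin d)) : wder w (fun _ => (0 : ℂ)) = fun _ => 0 := by
  induction w with
  | nil => rfl
  | cons i w ih => rw [wder_cons, ih]; ext x; simp [pder]

lemma pder_translate (f : Rd d → ℂ) (h : Rd d) (i : Fin d) :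
    pder i (fun x => f (x + h)) = fun x => pder i f (x + h) := by
  ext x
  simp only [pder]
  rw [fderiv_comp_add_right]

lemma wder_translate (f : Rd d → ℂ) (h : Rd d) (w : List (Fin d)) :
    wder w (fun x => f (x + h)) = fun x => wder w f (x + h) := by
  induction w with
  | nil => rfl
  | cons i w ih => rw [wder_cons, ih, pder_translate]; rfl

lemma mderiv_translate (f : Rd d → ℂ) (h : Rd d) (α : Fin d → ℕ) :
    mderiv α (fun x => f (x + h)) = fun x => mderiv α f (x + h) := by
  simp only [mderiv_eq_wder, wder_translate]

lemma tsupport_pder_subset (f : Rd d → ℂ) (i : Fin d) : tsupport (pder i f) ⊆ tsupport f := by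
  refine closure_minimal ?_ isClosed_closure
  intro x hx
  apply support_fderiv_subset ℝ (f := f)
  intro h
  apply hx
  simp [pder, h]

lemma tsupport_wder_subset (f : Rd d → ℂ) (w : List (Fin d)) :
    tsupport (wder w f) ⊆ tsupport f := by
  induction w with
  | nil => exact subset_rfl
  | cons i w ih => exact (tsupport_pder_subset _ i).trans ih

lemma wder_eq_zero_of_notMem {f : Rd d → ℂ} {x : Rd d} (hx : x ∉ tsupport f)
    (w : List (Fin d)) : wder w f x = 0 :=
  image_eq_zero_of_notMem_tsupport fun h => hx (tsupport_wder_subset f w h)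

/-- Pointwise Leibniz estimate for word derivatives of a product. -/
lemma norm_wder_mul_le (x : Rd d) (w : List (Fin d)) : ∀ {f g : Rd d → ℂ}, Smooth f → Smooth g →
    ∀ {U V W : ℕ → ℝ}, (∀ p, 0 ≤ V p) → (∀ v, ‖wder v f x‖ ≤ U v.length) →
    (∀ v, ‖wder v g x‖ ≤ V v.length) → (∀ p q, U p * V q ≤ W (p + q)) →
    ‖wder w (fun y => f y * g y) x‖ ≤ 2 ^ w.length * W w.length := by
  induction w using List.reverseRecOn with
  | nil =>
    intro f g hf hg U V W hV hU hV' hW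
    simp only [wder_nil, norm_mul, List.length_nil, pow_zero, one_mul]
    calc ‖f x‖ * ‖g x‖ ≤ U 0 * V 0 :=
          mul_le_mul (hU []) (hV' []) (norm_nonneg _) ((norm_nonneg _).trans (hU []))
      _ ≤ W 0 := hW 0 0
  | append_singleton w i ih =>
    intro f g hf hg U V W hV hU hV' hW
    have e1 := ih hf (hg.pder i) (U := U) (V := fun p => V (p + 1)) (W := fun p => W (p + 1))
      (fun p => hV _) hU (fun v => by
        simpa [wder_append] using hV' (v ++ [i])) (fun p q => by
        simpa [add_assoc] using hW p (q + 1))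
    have e2 := ih (hf.pder i) hg (U := fun p => U (p + 1)) (V := V) (W := fun p => W (p + 1))
      hV (fun v => by simpa [wder_append] using hU (v ++ [i])) hV' (fun p q => by
        have := hW (p + 1) q
        rwa [show p + 1 + q = p + q + 1 by ring] at this)
    have hs1 : Smooth (fun y => f y * pder i g y) := hf.mul (hg.pder i)
    have hs2 : Smooth (fun y => pder i f y * g y) := (hf.pder i).mul hg
    rw [wder_append, wder_cons, wder_nil, pder_mul hf hg, wder_add hs1 hs2]
    refine (norm_add_le _ _).trans ((add_le_add e1 e2).trans (le_of_eq ?_))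
    simp [pow_succ]; ring

/-- Global Beurling estimates for all word derivatives, uniformly over a family of functions. -/
def UnifBeurling {ι : Type*} (M : ℕ → ℝ) (g : ι → Rd d → ℂ) : Prop :=
  ∀ ε > (0 : ℝ), ∃ C : ℝ, 0 ≤ C ∧ ∀ n w x,
    ‖wder w (g n) x‖ ≤ C * (ε ^ w.length * M w.length)

/-- Global Beurling estimates for all word derivatives of a function. -/
def Beurling (M : ℕ → ℝ) (φ : Rd d → ℂ) : Prop :=
  ∀ ε > (0 : ℝ), ∃ C : ℝ, 0 ≤ C ∧ ∀ w x, ‖wder w φ x‖ ≤ C * (ε ^ w.length * M w.length)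

lemma isTestD_iff {M : ℕ → ℝ} (hM : ∀ p, 0 < M p) {φ : Rd d → ℂ} :
    IsTestD M φ ↔ Smooth φ ∧ HasCompactSupport φ ∧ Beurling M φ := by
  refine and_congr_right fun hs => and_congr_right fun _ => forall₂_congr fun ε hε => ?_
  constructor
  · rintro ⟨C, hC⟩
    refine ⟨max C 0, le_max_right _ _, fun w x => ?_⟩
    have hpos : 0 < ε ^ w.length * M w.length := mul_pos (pow_pos hε _) (hM _)
    by_cases hx : x ∈ tsupport φ
    · have := hC ⟨fun i => w.count i, x, hx, rfl⟩
      rw [mOrd_count, ← wder_eq_mderiv hs, div_le_iff₀ hpos] at this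
      exact this.trans (mul_le_mul_of_nonneg_right (le_max_left _ _) hpos.le)
    · rw [wder_eq_zero_of_notMem hx, norm_zero]
      exact mul_nonneg (le_max_right _ _) hpos.le
  · rintro ⟨C, -, hC⟩
    refine ⟨C, ?_⟩
    rintro r ⟨α, x, -, rfl⟩
    have hpos : 0 < ε ^ mOrd α * M (mOrd α) := mul_pos (pow_pos hε _) (hM _)
    rw [div_le_iff₀ hpos, mderiv_eq_wder, ← length_mword]
    exact hC _ _

lemma IsTestD.smooth {M : ℕ → ℝ} {φ : Rd d → ℂ} (h : IsTestD M φ) : Smooth φ := h.1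

lemma IsTestD.beurling {M : ℕ → ℝ} (hM : ∀ p, 0 < M p) {φ : Rd d → ℂ} (h : IsTestD M φ) :
    Beurling M φ := ((isTestD_iff hM).1 h).2.2

lemma Beurling.const_mul {M : ℕ → ℝ} {φ : Rd d → ℂ} (hs : Smooth φ) (h : Beurling M φ) (c : ℂ) :
    Beurling M (fun x => c * φ x) := by
  intro ε hε
  obtain ⟨C, hC, hb⟩ := h ε hε
  refine ⟨‖c‖ * C, by positivity, fun w x => ?_⟩
  rw [wder_const_mul c hs, norm_mul, mul_assoc]
  exact mul_le_mul_of_nonneg_left (hb w x) (norm_nonneg _)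

lemma tsupport_translate (φ : Rd d → ℂ) (h : Rd d) :
    tsupport (fun x => φ (x - h)) = (fun x => x - h) ⁻¹' tsupport φ := by
  have := tsupport_comp_eq_preimage φ (Homeomorph.subRight h)
  exact this

lemma IsTestD.translate {M : ℕ → ℝ} (hM : ∀ p, 0 < M p) {φ : Rd d → ℂ} (hφ : IsTestD M φ)
    (h : Rd d) : IsTestD M (fun x => φ (x - h)) := by
  rw [isTestD_iff hM] at hφ ⊢
  obtain ⟨h1, h2, h3⟩ := hφ
  refine ⟨h1.comp (contDiff_id.sub contDiff_const),
    h2.comp_homeomorph (Homeomorph.subRight h), fun ε hε => ?_⟩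
  obtain ⟨C, hC, hb⟩ := h3 ε hε
  refine ⟨C, hC, fun w x => ?_⟩
  simp only [sub_eq_add_neg, wder_translate]
  exact hb _ _

lemma Enorm_le {M : ℕ → ℝ} (hM : ∀ p, 0 < M p) {ℓ : ℝ} (hℓ : 0 < ℓ) {K : Set (Rd d)}
    {φ : Rd d → ℂ} {B : ℝ} (hB : 0 ≤ B)
    (h : ∀ w, ∀ x ∈ K, ‖wder w φ x‖ ≤ B * (ℓ ^ w.length * M w.length)) :
    Enorm M ℓ K φ ≤ B := by
  refine Real.sSup_le ?_ hB
  rintro r ⟨α, x, hx, rfl⟩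
  rw [div_le_iff₀ (mul_pos (pow_pos hℓ _) (hM _)), mderiv_eq_wder, ← length_mword]
  exact h _ x hx

lemma Enorm_nonneg {M : ℕ → ℝ} (hM : ∀ p, 0 < M p) {ℓ : ℝ} (hℓ : 0 < ℓ) (K : Set (Rd d))
    (φ : Rd d → ℂ) : 0 ≤ Enorm M ℓ K φ := by
  refine Real.sSup_nonneg ?_
  rintro r ⟨α, x, hx, rfl⟩
  have := hM (mOrd α)
  positivity

lemma norm_wder_le_Enorm {M : ℕ → ℝ} (hM : ∀ p, 0 < M p) {ℓ : ℝ} (hℓ : 0 < ℓ) {K : Set (Rd d)}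
    {φ : Rd d → ℂ} (hφ : IsTestD M φ) (hK : tsupport φ ⊆ K) (w : List (Fin d)) (x : Rd d) :
    ‖wder w φ x‖ ≤ Enorm M ℓ K φ * (ℓ ^ w.length * M w.length) := by
  have hpos : 0 < ℓ ^ w.length * M w.length := mul_pos (pow_pos hℓ _) (hM _)
  by_cases hx : x ∈ tsupport φ
  · rw [← div_le_iff₀ hpos]
    refine le_csSup ?_ ⟨fun i => w.count i, x, hK hx, ?_⟩
    · obtain ⟨C, -, hC⟩ := hφ.beurling hM ℓ hℓ
      refine ⟨C, ?_⟩
      rintro r ⟨α, x, -, rfl⟩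
      rw [div_le_iff₀ (mul_pos (pow_pos hℓ _) (hM _)), mderiv_eq_wder, ← length_mword]
      exact hC _ _
    · rw [mOrd_count, ← wder_eq_mderiv hφ.smooth]
  · rw [wder_eq_zero_of_notMem hx, norm_zero]
    exact mul_nonneg (Enorm_nonneg hM hℓ K φ) hpos.le

lemma clm_apply_eq_sum (L : Rd d →L[ℝ] ℂ) (v : Rd d) :
    L v = ∑ i, (v i : ℂ) * L (EuclideanSpace.single i 1) := by
  have hv : v = ∑ i, v i • EuclideanSpace.single i (1 : ℝ) := by
    ext j; simp [Pi.single_apply]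
  conv_lhs => rw [hv]
  simp

lemma norm_fderiv_le_sum_pder (f : Rd d → ℂ) (x : Rd d) :
    ‖fderiv ℝ f x‖ ≤ ∑ i, ‖pder i f x‖ := by
  refine ContinuousLinearMap.opNorm_le_bound _ (Finset.sum_nonneg fun _ _ => norm_nonneg _) ?_
  intro v
  rw [clm_apply_eq_sum, Finset.sum_mul]
  refine (norm_sum_le _ _).trans (Finset.sum_le_sum fun i _ => ?_)
  rw [norm_mul, mul_comm]
  refine mul_le_mul_of_nonneg_left ?_ (norm_nonneg _)
  simpa using PiLp.norm_apply_le v i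

section Series

variable {ι : Type*} {g : ι → Rd d → ℂ} {c : ι → ℂ}

lemma summable_const_mul_of_bounded (hc : Summable fun n => ‖c n‖) {u : ι → ℂ} {B : ℝ}
    (hu : ∀ n, ‖u n‖ ≤ B) : Summable fun n => c n * u n :=
  Summable.of_norm_bounded (hc.mul_right B) fun n => by
    rw [norm_mul]; exact mul_le_mul_of_nonneg_left (hu n) (norm_nonneg _)

lemma norm_tsum_mul_le (hc : Summable fun n => ‖c n‖) {u : ι → ℂ} {B : ℝ}
    (hu : ∀ n, ‖u n‖ ≤ B) : ‖∑' n, c n * u n‖ ≤ (∑' n, ‖c n‖) * B := by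
  rw [← tsum_mul_right]
  exact tsum_of_norm_bounded (hc.mul_right B).hasSum fun n => by
    rw [norm_mul]; exact mul_le_mul_of_nonneg_left (hu n) (norm_nonneg _)

lemma hasFDerivAt_series (hc : Summable fun n => ‖c n‖) (hg : ∀ n, Smooth (g n))
    (hb : ∀ w, ∃ B, ∀ n x, ‖wder w (g n) x‖ ≤ B) (x : Rd d) :
    HasFDerivAt (fun y => ∑' n, c n * g n y) (∑' n, c n • fderiv ℝ (g n) x) x := by
  obtain ⟨B₀, hB₀⟩ := hb []
  choose B hB using fun i => hb [i]
  refine hasFDerivAt_tsum (E := Rd d) (F := ℂ) (𝕜 := ℝ) (f := fun n y => c n * g n y)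
    (f' := fun n y => c n • fderiv ℝ (g n) y) (u := fun n => ‖c n‖ * ∑ i, B i)
    (hc.mul_right _) (x₀ := 0) ?_ ?_ ?_ x
  · intro n y
    exact ((hg n).differentiable y).hasFDerivAt.const_mul (c n)
  · intro n y
    rw [norm_smul]
    refine mul_le_mul_of_nonneg_left ?_ (norm_nonneg _)
    exact (norm_fderiv_le_sum_pder _ _).trans (Finset.sum_le_sum fun i _ => hB i n y)
  · exact summable_const_mul_of_bounded hc (fun n => hB₀ n 0)

lemma summable_fderiv_series (hc : Summable fun n => ‖c n‖)
    (hb : ∀ w, ∃ B, ∀ n x, ‖wder w (g n) x‖ ≤ B) (x : Rd d) :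
    Summable fun n => c n • fderiv ℝ (g n) x := by
  choose B hB using fun i => hb [i]
  refine Summable.of_norm_bounded (hc.mul_right (∑ i, B i)) fun n => ?_
  rw [norm_smul]
  refine mul_le_mul_of_nonneg_left ?_ (norm_nonneg _)
  exact (norm_fderiv_le_sum_pder _ _).trans (Finset.sum_le_sum fun i _ => hB i n x)

lemma pder_series (hc : Summable fun n => ‖c n‖) (hg : ∀ n, Smooth (g n))
    (hb : ∀ w, ∃ B, ∀ n x, ‖wder w (g n) x‖ ≤ B) (i : Fin d) :
    pder i (fun y => ∑' n, c n * g n y) = fun y => ∑' n, c n * pder i (g n) y := by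
  ext x
  have h := (hasFDerivAt_series hc hg hb x).fderiv
  have hs := summable_fderiv_series hc hb x
  unfold pder
  rw [h]
  have := (ContinuousLinearMap.apply ℝ ℂ (EuclideanSpace.single i (1 : ℝ))).map_tsum hs
  simpa using this

lemma bounded_pder_family (hb : ∀ w, ∃ B, ∀ n x, ‖wder w (g n) x‖ ≤ B) (i : Fin d) :
    ∀ w, ∃ B, ∀ n x, ‖wder w (pder i (g n)) x‖ ≤ B := fun w => by
  simpa [wder_append] using hb (w ++ [i])

lemma contDiff_nat_series (hc : Summable fun n => ‖c n‖) (N : ℕ) :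
    ∀ {g : ι → Rd d → ℂ}, (∀ n, Smooth (g n)) → (∀ w, ∃ B, ∀ n x, ‖wder w (g n) x‖ ≤ B) →
    ContDiff ℝ N (fun y => ∑' n, c n * g n y) := by
  induction N with
  | zero =>
    intro g hg hb
    have hd : Differentiable ℝ (fun y => ∑' n, c n * g n y) :=
      fun x => (hasFDerivAt_series hc hg hb x).differentiableAt
    exact contDiff_zero.2 hd.continuous
  | succ N ih =>
    intro g hg hb
    have hd : Differentiable ℝ (fun y => ∑' n, c n * g n y) :=
      fun x => (hasFDerivAt_series hc hg hb x).differentiableAt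
    push_cast
    rw [contDiff_succ_iff_fderiv]
    refine ⟨hd, by simp, contDiff_clm_apply_iff.2 fun v => ?_⟩
    have : (fun x => fderiv ℝ (fun y => ∑' n, c n * g n y) x v) =
        fun x => ∑ i, (v i : ℂ) * ∑' n, c n * pder i (g n) x := by
      ext x
      rw [clm_apply_eq_sum]
      refine Finset.sum_congr rfl fun i _ => ?_
      rw [← congrFun (pder_series hc hg hb i) x]; rfl
    rw [this]
    exact ContDiff.sum fun i _ => contDiff_const.mul
      (ih (fun n => (hg n).pder i) (bounded_pder_family hb i))

lemma smooth_series (hc : Summable fun n => ‖c n‖) (hg : ∀ n, Smooth (g n))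
    (hb : ∀ w, ∃ B, ∀ n x, ‖wder w (g n) x‖ ≤ B) : Smooth (fun y => ∑' n, c n * g n y) :=
  contDiff_infty.2 fun N => contDiff_nat_series hc N hg hb

lemma wder_series (hc : Summable fun n => ‖c n‖) (w : List (Fin d)) :
    ∀ {g : ι → Rd d → ℂ}, (∀ n, Smooth (g n)) → (∀ w, ∃ B, ∀ n x, ‖wder w (g n) x‖ ≤ B) →
    wder w (fun y => ∑' n, c n * g n y) = fun y => ∑' n, c n * wder w (g n) y := by
  induction w using List.reverseRecOn with
  | nil => intros; rfl
  | append_singleton w i ih =>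
    intro g hg hb
    simp only [wder_append, wder_cons, wder_nil]
    rw [pder_series hc hg hb, ih (fun n => (hg n).pder i) (bounded_pder_family hb i)]

lemma UnifBeurling.bounded {M : ℕ → ℝ} (h : UnifBeurling M g) :
    ∀ w, ∃ B, ∀ n x, ‖wder w (g n) x‖ ≤ B := fun w => by
  obtain ⟨C, -, hC⟩ := h 1 one_pos
  exact ⟨_, fun n x => hC n w x⟩

lemma norm_wder_series_le {M : ℕ → ℝ} (hc : Summable fun n => ‖c n‖) (hg : ∀ n, Smooth (g n))
    (hb : UnifBeurling M g) {ε C : ℝ}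
    (hC : ∀ n w x, ‖wder w (g n) x‖ ≤ C * (ε ^ w.length * M w.length)) (w : List (Fin d))
    (x : Rd d) : ‖wder w (fun y => ∑' n, c n * g n y) x‖ ≤
      (∑' n, ‖c n‖) * C * (ε ^ w.length * M w.length) := by
  rw [wder_series hc w hg hb.bounded, mul_assoc]
  exact norm_tsum_mul_le hc fun n => hC n w x

lemma tsupport_series_subset {K : Set (Rd d)} (hK : IsClosed K) (hg : ∀ n, tsupport (g n) ⊆ K) :
    tsupport (fun y => ∑' n, c n * g n y) ⊆ K := by
  refine closure_minimal (fun x hx => ?_) hK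
  by_contra hxK
  refine hx ?_
  have : ∀ n, g n x = 0 := fun n => image_eq_zero_of_notMem_tsupport fun h => hxK (hg n h)
  simp [this]

lemma isTestD_series {M : ℕ → ℝ} (hM : ∀ p, 0 < M p) (hc : Summable fun n => ‖c n‖)
    (hg : ∀ n, Smooth (g n)) (hb : UnifBeurling M g) {K : Set (Rd d)} (hK : IsCompact K)
    (hgK : ∀ n, tsupport (g n) ⊆ K) : IsTestD M (fun y => ∑' n, c n * g n y) := by
  rw [isTestD_iff hM]
  refine ⟨smooth_series hc hg hb.bounded,
    hK.of_isClosed_subset (isClosed_tsupport _) (tsupport_series_subset hK.isClosed hgK), ?_⟩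
  intro ε hε
  obtain ⟨C, hC, hCb⟩ := hb ε hε
  exact ⟨(∑' n, ‖c n‖) * C, mul_nonneg (tsum_nonneg fun _ => norm_nonneg _) hC,
    norm_wder_series_le hc hg hb hCb⟩

end Series

/-- A family of test functions with `n`-th member normalised in the norm of index `1/(n+1)`
satisfies uniform Beurling estimates. -/
lemma unifBeurling_of_normalised {M : ℕ → ℝ} (hM : ∀ p, 0 < M p) {g : ℕ → Rd d → ℂ}
    (hg : ∀ n, Beurling M (g n))
    (hn : ∀ n w x, ‖wder w (g n) x‖ ≤ (1 / ((n : ℝ) + 1)) ^ w.length * M w.length) :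
    UnifBeurling M g := by
  intro ε hε
  choose C hC0 hC using fun n => hg n ε hε
  obtain ⟨N, hN⟩ := exists_nat_one_div_lt hε
  refine ⟨1 + ∑ n ∈ Finset.range N, C n, ?_, fun n w x => ?_⟩
  · have := Finset.sum_nonneg (s := Finset.range N) fun n _ => hC0 n
    linarith
  have hpos : 0 ≤ ε ^ w.length * M w.length := mul_nonneg (pow_nonneg hε.le _) (hM _).le
  by_cases h : n < N
  · refine (hC n w x).trans (mul_le_mul_of_nonneg_right ?_ hpos)
    have := Finset.single_le_sum (f := C) (fun n _ => hC0 n) (Finset.mem_range.2 h)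
    linarith
  · push Not at h
    have h1 : (1 / ((n : ℝ) + 1)) ≤ ε := by
      refine le_trans ?_ hN.le
      gcongr
    have h2 : (1 : ℝ) ≤ 1 + ∑ n ∈ Finset.range N, C n := by
      have := Finset.sum_nonneg (s := Finset.range N) fun n _ => hC0 n
      linarith
    calc ‖wder w (g n) x‖ ≤ (1 / ((n : ℝ) + 1)) ^ w.length * M w.length := hn n w x
      _ ≤ ε ^ w.length * M w.length := by
          refine mul_le_mul_of_nonneg_right ?_ (hM _).le
          gcongr
      _ ≤ _ := le_mul_of_one_le_left hpos h2

lemma lp_one_summable (c : lp (fun _ : ℕ => ℂ) 1) : Summable fun n => ‖c n‖ := by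
  simpa using (lp.memℓp c).summable (by simp)

lemma lp_one_norm (c : lp (fun _ : ℕ => ℂ) 1) : ‖c‖ = ∑' n, ‖c n‖ := by
  simpa using lp.norm_eq_tsum_rpow (p := 1) (by simp) c

/-- Uniform boundedness along a uniformly Beurling sequence of test functions. -/
lemma uniform_bound_of_pointwise {M : ℕ → ℝ} (hM : ∀ p, 0 < M p) {ω : Rd d → ℝ}
    (hω : ∀ x, 0 < ω x) {f : (Rd d → ℂ) →ₗ[ℂ] ℂ} (hf : IsUltraD M f)
    (hb : ∀ φ : Rd d → ℂ, IsTestD M φ →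
      ∃ C : ℝ, ∀ h : Rd d, ‖f (fun x => φ (x - h))‖ ≤ C * ω h)
    {K : Set (Rd d)} (hK : IsCompact K) {g : ℕ → Rd d → ℂ} (hg : ∀ n, Smooth (g n))
    (hgB : UnifBeurling M g) (hgK : ∀ n, tsupport (g n) ⊆ K) :
    ∃ C : ℝ, ∀ n h, ‖f (fun x => g n (x - h))‖ ≤ C * ω h := by
  have hsum : ∀ (c : lp (fun _ : ℕ => ℂ) 1) (x : Rd d), Summable fun n => c n * g n x := by
    intro c x
    obtain ⟨B, hB⟩ := hgB.bounded []
    exact summable_const_mul_of_bounded (lp_one_summable c) fun n => hB n x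
  let S : lp (fun _ : ℕ => ℂ) 1 → Rd d → ℂ := fun c y => ∑' n, c n * g n y
  have hST : ∀ c, IsTestD M (S c) := fun c =>
    isTestD_series hM (lp_one_summable c) hg hgB hK hgK
  have hSK : ∀ c, tsupport (S c) ⊆ K := fun c => tsupport_series_subset hK.isClosed hgK
  let T : Rd d → lp (fun _ : ℕ => ℂ) 1 →ₗ[ℂ] ℂ := fun h =>
    { toFun := fun c => (ω h : ℂ)⁻¹ * f (fun x => S c (x - h))
      map_add' := fun a b => by
        rw [← mul_add, ← map_add]
        congr 2
        ext x
        simp only [S, Pi.add_apply, lp.coeFn_add, add_mul]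
        exact (hsum a _).tsum_add (hsum b _)
      map_smul' := fun a b => by
        have : (fun x => S (a • b) (x - h)) = a • fun x => S b (x - h) := by
          ext x
          simp only [S, Pi.smul_apply, lp.coeFn_smul, smul_eq_mul, mul_assoc]
          exact tsum_mul_left
        rw [this, map_smul]
        simp [mul_left_comm] }
  have hTnorm : ∀ h c, ‖T h c‖ = (ω h)⁻¹ * ‖f (fun x => S c (x - h))‖ := by
    intro h c
    simp [T, abs_of_pos (hω h)]
  have hTb : ∀ h, ∃ C, ∀ c, ‖T h c‖ ≤ C * ‖c‖ := by
    intro h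
    have hKh : IsCompact ((fun x => x + h) '' K) := hK.image (by fun_prop)
    obtain ⟨ℓ, hℓ, C, hC, hfC⟩ := hf _ hKh
    obtain ⟨B, hB, hgb⟩ := hgB ℓ hℓ
    refine ⟨(ω h)⁻¹ * (C * B), fun c => ?_⟩
    rw [hTnorm, mul_assoc]
    refine mul_le_mul_of_nonneg_left ?_ (inv_nonneg.2 (hω h).le)
    refine (hfC _ ((hST c).translate hM h) ?_).trans ?_
    · rw [tsupport_translate]
      intro x hx
      exact ⟨x - h, hSK c hx, by simp⟩
    · rw [mul_assoc]
      refine mul_le_mul_of_nonneg_left ?_ hC.le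
      refine Enorm_le hM hℓ (by positivity) fun w x _ => ?_
      simp only [sub_eq_add_neg, wder_translate]
      rw [lp_one_norm, mul_comm B]
      exact norm_wder_series_le (lp_one_summable c) hg hgB hgb w _
  choose CT hCT using hTb
  let L : Rd d → lp (fun _ : ℕ => ℂ) 1 →L[ℂ] ℂ := fun h => (T h).mkContinuous (CT h) (hCT h)
  obtain ⟨C, hC⟩ := banach_steinhaus (g := L) fun c => by
    obtain ⟨C, hC⟩ := hb (S c) (hST c)
    refine ⟨C, fun h => ?_⟩
    change ‖T h c‖ ≤ C
    rw [hTnorm, inv_mul_le_iff₀ (hω h), mul_comm]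
    exact hC h
  refine ⟨C, fun n h => ?_⟩
  have h1 := (L h).le_of_opNorm_le (hC h) (lp.single 1 n 1)
  change ‖T h _‖ ≤ _ at h1
  have h2 : S (lp.single 1 n 1) = g n := by
    ext x
    simp only [S]
    rw [tsum_eq_single n]
    · simp
    · intro m hm
      simp [lp.single_apply, Pi.single_eq_of_ne hm]
  rw [hTnorm, h2, lp.norm_single (by simp), norm_one, mul_one, inv_mul_le_iff₀ (hω h),
    mul_comm] at h1
  exact h1

/-- Equicontinuity of the translates of `f` divided by `ω`. -/
lemma equicontinuous_translates {M : ℕ → ℝ} (hM : ∀ p, 0 < M p) {ω : Rd d → ℝ}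
    (hω : ∀ x, 0 < ω x) {f : (Rd d → ℂ) →ₗ[ℂ] ℂ} (hf : IsUltraD M f)
    (hb : ∀ φ : Rd d → ℂ, IsTestD M φ →
      ∃ C : ℝ, ∀ h : Rd d, ‖f (fun x => φ (x - h))‖ ≤ C * ω h)
    {K : Set (Rd d)} (hK : IsCompact K) :
    ∃ ℓ > (0 : ℝ), ∃ C > (0 : ℝ), ∀ φ : Rd d → ℂ, IsTestD M φ → tsupport φ ⊆ K →
      ∀ h, ‖f (fun x => φ (x - h))‖ ≤ C * ω h * Enorm M ℓ K φ := by
  by_contra hcon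
  push Not at hcon
  choose φ hφ hφK h hφh using fun n : ℕ =>
    hcon (1 / ((n : ℝ) + 1)) (by positivity) ((n : ℝ) + 1) (by positivity)
  have hnn : ∀ n : ℕ, 0 < 1 / ((n : ℝ) + 1) := fun n => by positivity
  set e : ℕ → ℝ := fun n => Enorm M (1 / ((n : ℝ) + 1)) K (φ n) with he
  have hφw := fun n => norm_wder_le_Enorm hM (hnn n) (hφ n) (hφK n)
  have hepos : ∀ n, 0 < e n := by
    intro n
    refine lt_of_le_of_ne (Enorm_nonneg hM (hnn n) K (φ n)) fun h0 => ?_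
    replace h0 : Enorm M (1 / ((n : ℝ) + 1)) K (φ n) = 0 := h0.symm
    have hz : φ n = 0 := by
      ext x
      have := hφw n [] x
      rw [h0, zero_mul] at this
      simpa using this
    have := hφh n
    rw [h0, hz] at this
    have hz' : (fun x : Rd d => (0 : Rd d → ℂ) (x - h n)) = 0 := rfl
    rw [hz', map_zero] at this
    simp at this
  let g : ℕ → Rd d → ℂ := fun n x => ((e n : ℂ)⁻¹) * φ n x
  have hgs : ∀ n, Smooth (g n) := fun n => contDiff_const.mul (hφ n).smooth
  have hgK : ∀ n, tsupport (g n) ⊆ K := fun n =>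
    (closure_mono (by intro x hx hx0; apply hx; simp [g, hx0])).trans (hφK n)
  have hgB : UnifBeurling M g := by
    refine unifBeurling_of_normalised hM
      (fun n => ((hφ n).beurling hM).const_mul (hφ n).smooth _) fun n w x => ?_
    have := hφw n w x
    simp only [g]
    rw [wder_const_mul _ (hφ n).smooth, norm_mul, norm_inv, Complex.norm_real, Real.norm_eq_abs,
      abs_of_pos (hepos n), inv_mul_le_iff₀ (hepos n)]
    exact this
  obtain ⟨C, hC⟩ := uniform_bound_of_pointwise hM hω hf hb hK hgs hgB hgK
  obtain ⟨n, hn⟩ := exists_nat_gt C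
  have h1 := hC n (h n)
  have h2 := hφh n
  have h3 : (fun x => g n (x - h n)) = ((e n : ℂ)⁻¹) • fun x => φ n (x - h n) := rfl
  rw [h3, map_smul, norm_smul, norm_inv, Complex.norm_real, Real.norm_eq_abs,
      abs_of_pos (hepos n), inv_mul_le_iff₀ (hepos n)] at h1
  have h4 : ((n : ℝ) + 1) * ω (h n) * e n < e n * (C * ω (h n)) := h2.trans_le h1
  have h5 := mul_pos (hω (h n)) (hepos n)
  nlinarith

section

open Filter Topology

/-- A summable positive sequence can be multiplied by a sequence tending to infinity, with the
product having arbitrarily prescribed bound on its partial sums. -/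
lemma exists_summable_inflation {r : ℕ → ℝ} (hr : ∀ j, 0 < r j) (hs : Summable r) {δ : ℝ}
    (hδ : 0 < δ) : ∃ v : ℕ → ℝ, (∀ j, 0 < v j) ∧ Tendsto v atTop (𝓝 0) ∧
      Summable (fun j => r j / v j) ∧ ∑' j, r j / v j ≤ δ := by
  set T : ℕ → ℝ := fun n => ∑' j, r (j + n) with hT
  have hsn : ∀ n, Summable fun j => r (j + n) := fun n => (summable_nat_add_iff n).2 hs
  have hTpos : ∀ n, 0 < T n := fun n =>
    (hsn n).tsum_pos (fun j => (hr _).le) 0 (hr _)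
  have hTsucc : ∀ n, T n = r n + T (n + 1) := fun n => by
    have h := (hsn n).tsum_eq_zero_add
    simp only [hT, h, zero_add]
    congr 1
    exact tsum_congr fun j => by congr 1; ring
  have hT0 : Tendsto T atTop (𝓝 0) := tendsto_sum_nat_add r
  have hsq : Tendsto (fun n => √(T n)) atTop (𝓝 0) := by
    simpa using hT0.sqrt
  have hpos : ∀ n, 0 < √(T n) := fun n => Real.sqrt_pos.2 (hTpos n)
  have hstep : ∀ n, r n / √(T n) ≤ 2 * (√(T n) - √(T (n + 1))) := fun n => by
    rw [div_le_iff₀ (hpos n)]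
    have h1 := Real.sq_sqrt (hTpos n).le
    have h2 := Real.sq_sqrt (hTpos (n + 1)).le
    have h3 := hTsucc n
    have h4 : √(T (n + 1)) ≤ √(T n) := Real.sqrt_le_sqrt (by linarith [hr n])
    nlinarith [sq_nonneg (√(T n) - √(T (n + 1)))]
  have hpartial : ∀ n, ∑ j ∈ Finset.range n, r j / √(T j) ≤ 2 * √(T 0) := fun n => by
    refine (Finset.sum_le_sum fun j _ => hstep j).trans ?_
    rw [← Finset.mul_sum, Finset.sum_range_sub']
    linarith [hpos n]
  set c := δ / (2 * √(T 0)) with hc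
  have hc0 : 0 < c := by have := hpos 0; positivity
  have hle : ∀ n, ∑ j ∈ Finset.range n, r j / (√(T j) / c) ≤ δ := fun n => by
    have h : ∀ j, r j / (√(T j) / c) = c * (r j / √(T j)) := fun j => by field_simp
    simp_rw [h]
    rw [← Finset.mul_sum]
    refine (mul_le_mul_of_nonneg_left (hpartial n) hc0.le).trans (le_of_eq ?_)
    have := hpos 0
    rw [hc]; field_simp
  have hnn : ∀ j, 0 ≤ r j / (√(T j) / c) := fun j => by
    have := hpos j; have := hr j; positivity
  refine ⟨fun j => √(T j) / c, fun j => div_pos (hpos j) hc0, by simpa using hsq.div_const c,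
    summable_of_sum_range_le hnn hle, Real.tsum_le_of_sum_range_le hnn hle⟩

/-- Products of a null sequence grow slower than any geometric sequence. -/
lemma exists_prod_le_geometric {v : ℕ → ℝ} (hv : ∀ j, 0 < v j) (h0 : Tendsto v atTop (𝓝 0))
    {ε : ℝ} (hε : 0 < ε) : ∃ C, 0 ≤ C ∧ ∀ p, ∏ j ∈ Finset.range p, v j ≤ C * ε ^ p := by
  obtain ⟨N, hN⟩ := eventually_atTop.1 (h0.eventually_le_const hε)
  set q : ℕ → ℝ := fun p => (∏ j ∈ Finset.range p, v j) / ε ^ p with hq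
  have hq0 : ∀ p, 0 < q p := fun p => div_pos (Finset.prod_pos fun j _ => hv j) (pow_pos hε _)
  refine ⟨∑ p ∈ Finset.range (N + 1), q p, Finset.sum_nonneg fun p _ => (hq0 p).le, ?_⟩
  have key : ∀ p, q p ≤ ∑ p ∈ Finset.range (N + 1), q p := by
    intro p
    rcases le_total p N with h | h
    · exact Finset.single_le_sum (fun p _ => (hq0 p).le) (Finset.mem_range.2 (by omega))
    · induction p, h using Nat.le_induction with
      | base => exact Finset.single_le_sum (fun p _ => (hq0 p).le) (Finset.mem_range.2 (by omega))
      | succ n hn ih =>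
        refine le_trans ?_ ih
        have : q (n + 1) = q n * (v n / ε) := by
          simp only [hq, Finset.prod_range_succ, pow_succ]; field_simp
        rw [this]
        exact mul_le_of_le_one_right (hq0 n).le ((div_le_one hε).2 (hN n hn))
  intro p
  rw [← div_le_iff₀ (pow_pos hε p)]
  exact key p

/-- The one-sided moving average of width `a`. -/
def boxAvg (a : ℝ) (u : ℝ → ℝ) (x : ℝ) : ℝ := a⁻¹ * ∫ t in x..x + a, u t

lemma boxAvg_eq {a : ℝ} {u : ℝ → ℝ} (hu : Continuous u) (x : ℝ) :
    boxAvg a u x = a⁻¹ * ((∫ t in (0 : ℝ)..x + a, u t) - ∫ t in (0 : ℝ)..x, u t) := by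
  rw [boxAvg, intervalIntegral.integral_interval_sub_left (hu.intervalIntegrable _ _)
    (hu.intervalIntegrable _ _)]

lemma hasDerivAt_boxAvg (a : ℝ) {u : ℝ → ℝ} (hu : Continuous u) (x : ℝ) :
    HasDerivAt (boxAvg a u) (a⁻¹ * (u (x + a) - u x)) x := by
  rw [funext (boxAvg_eq (a := a) hu)]
  have h : ∀ y, HasDerivAt (fun y => ∫ t in (0 : ℝ)..y, u t) (u y) y := fun y =>
    (hu.integral_hasStrictDerivAt 0 y).hasDerivAt
  exact (((h (x + a)).comp_add_const x a).sub (h x)).const_mul _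

lemma deriv_boxAvg (a : ℝ) {u : ℝ → ℝ} (hu : Continuous u) :
    deriv (boxAvg a u) = fun x => a⁻¹ * (u (x + a) - u x) :=
  funext fun x => (hasDerivAt_boxAvg a hu x).deriv

lemma contDiff_boxAvg (a : ℝ) {u : ℝ → ℝ} (hu : ContDiff ℝ (⊤ : ℕ∞) u) :
    ContDiff ℝ (⊤ : ℕ∞) (boxAvg a u) := by
  rw [contDiff_infty_iff_deriv]
  refine ⟨fun x => (hasDerivAt_boxAvg a hu.continuous x).differentiableAt, ?_⟩
  rw [deriv_boxAvg a hu.continuous]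
  exact contDiff_const.mul ((hu.comp (contDiff_id.add contDiff_const)).sub hu)

lemma iteratedDeriv_boxAvg (a : ℝ) (p : ℕ) : ∀ {u : ℝ → ℝ}, ContDiff ℝ (⊤ : ℕ∞) u →
    iteratedDeriv p (boxAvg a u) = boxAvg a (iteratedDeriv p u) := by
  induction p with
  | zero => intro u _; simp
  | succ p ih =>
    intro u hu
    have hd := (contDiff_infty_iff_deriv.1 hu)
    rw [iteratedDeriv_succ', iteratedDeriv_succ', ← ih hd.2]
    congr 1
    rw [deriv_boxAvg a hu.continuous]
    ext x
    rw [boxAvg, intervalIntegral.integral_deriv_eq_sub (fun y _ => hd.1 y)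
      (hd.2.continuous.intervalIntegrable _ _)]

lemma abs_boxAvg_sub_le {a : ℝ} (ha : 0 < a) {u : ℝ → ℝ} (hu : Continuous u) {x c B : ℝ}
    (h : ∀ t, x ≤ t → t ≤ x + a → |u t - c| ≤ B) : |boxAvg a u x - c| ≤ B := by
  have h1 : boxAvg a u x - c = a⁻¹ * ∫ t in x..x + a, (u t - c) := by
    rw [intervalIntegral.integral_sub (hu.intervalIntegrable _ _) (by simp), boxAvg]
    simp; field_simp
  have h2 := intervalIntegral.norm_integral_le_of_norm_le_const (a := x) (b := x + a)
    (f := fun t => u t - c) (C := B) (fun t ht => by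
      rw [Set.uIoc_of_le (by linarith)] at ht
      exact h t ht.1.le ht.2)
  rw [h1, abs_mul, abs_of_pos (inv_pos.2 ha)]
  rw [Real.norm_eq_abs, add_sub_cancel_left, abs_of_pos ha] at h2
  rw [inv_mul_le_iff₀ ha]
  linarith

/-- Successive moving averages of the smooth transition from `0` at `1/2` to `1` at `1`. -/
def stepSeq (a : ℕ → ℝ) : ℕ → ℝ → ℝ
  | 0 => fun x => Real.smoothTransition (2 * x - 1)
  | n + 1 => boxAvg (a n) (stepSeq a n)

lemma contDiff_stepSeq (a : ℕ → ℝ) : ∀ n, ContDiff ℝ (⊤ : ℕ∞) (stepSeq a n)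
  | 0 => Real.smoothTransition.contDiff.comp ((contDiff_const.mul contDiff_id).sub contDiff_const)
  | n + 1 => contDiff_boxAvg _ (contDiff_stepSeq a n)

lemma continuous_iteratedDeriv_stepSeq (a : ℕ → ℝ) (n p : ℕ) :
    Continuous (iteratedDeriv p (stepSeq a n)) :=
  (contDiff_stepSeq a n).continuous_iteratedDeriv p (mod_cast le_top)

lemma stepSeq_of_le {a : ℕ → ℝ} (ha : ∀ j, 0 < a j) (n : ℕ) : ∀ {x : ℝ},
    x ≤ 1 / 2 - ∑ j ∈ Finset.range n, a j → stepSeq a n x = 0 := by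
  induction n with
  | zero => 
    intro x hx
    exact Real.smoothTransition.zero_of_nonpos (by simp at hx; linarith)
  | succ n ih =>
    intro x hx
    rw [Finset.sum_range_succ] at hx
    have := abs_boxAvg_sub_le (ha n) (contDiff_stepSeq a n).continuous (x := x) (c := 0) (B := 0)
      (fun t _ h => by simp [ih (x := t) (by linarith)])
    simpa [stepSeq] using this

lemma stepSeq_of_ge {a : ℕ → ℝ} (ha : ∀ j, 0 < a j) (n : ℕ) : ∀ {x : ℝ},
    1 ≤ x → stepSeq a n x = 1 := by
  induction n with
  | zero => 
    intro x hx
    exact Real.smoothTransition.one_of_one_le (by linarith)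
  | succ n ih =>
    intro x hx
    have := abs_boxAvg_sub_le (ha n) (contDiff_stepSeq a n).continuous (x := x) (c := 1) (B := 0)
      (fun t h _ => by simp [ih (x := t) (by linarith)])
    have := abs_nonpos_iff.1 this
    simp only [stepSeq]; linarith

lemma exists_bound_iteratedDeriv_stepSeq_zero (a : ℕ → ℝ) (p : ℕ) :
    ∃ D, ∀ x, |iteratedDeriv p (stepSeq a 0) x| ≤ D := by
  rcases p with _ | p
  · refine ⟨1, fun x => ?_⟩
    rw [iteratedDeriv_zero, stepSeq, abs_of_nonneg (Real.smoothTransition.nonneg _)]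
    exact Real.smoothTransition.le_one _
  · have hcs : HasCompactSupport (deriv (stepSeq a 0)) := by
      refine HasCompactSupport.intro (isCompact_Icc (a := (1 / 2 : ℝ)) (b := 1)) fun x hx => ?_
      rw [Set.mem_Icc, not_and_or, not_le, not_le] at hx
      rcases hx with hx | hx
      · have : stepSeq a 0 =ᶠ[𝓝 x] fun _ => 0 := by
          filter_upwards [Iio_mem_nhds hx] with y hy
          exact Real.smoothTransition.zero_of_nonpos (by rw [Set.mem_Iio] at hy; linarith)
        rw [this.deriv_eq]; simp
      · have : stepSeq a 0 =ᶠ[𝓝 x] fun _ => 1 := by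
          filter_upwards [Ioi_mem_nhds hx] with y hy
          exact Real.smoothTransition.one_of_one_le (by rw [Set.mem_Ioi] at hy; linarith)
        rw [this.deriv_eq]; simp
    have hcs' : ∀ q, HasCompactSupport (iteratedDeriv q (deriv (stepSeq a 0))) := fun q => by
      induction q with
      | zero => simpa using hcs
      | succ q ih => rw [iteratedDeriv_succ]; exact ih.deriv
    have hc := continuous_iteratedDeriv_stepSeq a 0 (p + 1)
    rw [iteratedDeriv_succ'] at hc ⊢
    obtain ⟨D, hD⟩ := (hcs' p).exists_bound_of_continuous hc
    exact ⟨D, fun x => hD x⟩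

lemma abs_iteratedDeriv_stepSeq_succ_le {a : ℕ → ℝ} (ha : ∀ j, 0 < a j) {n p : ℕ} {D : ℝ}
    (h : ∀ x, |iteratedDeriv p (stepSeq a n) x| ≤ D) (x : ℝ) :
    |iteratedDeriv p (stepSeq a (n + 1)) x| ≤ D := by
  rw [stepSeq, iteratedDeriv_boxAvg _ _ (contDiff_stepSeq a n)]
  simpa using abs_boxAvg_sub_le (ha n) (continuous_iteratedDeriv_stepSeq a n p) (x := x) (c := 0)
    (B := D) (fun t _ _ => by simpa using h t)

lemma abs_iteratedDeriv_stepSeq_le {a : ℕ → ℝ} (ha : ∀ j, 0 < a j) {p : ℕ} {D : ℝ}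
    (h : ∀ x, |iteratedDeriv p (stepSeq a 0) x| ≤ D) (n : ℕ) (x : ℝ) :
    |iteratedDeriv p (stepSeq a n) x| ≤ D := by
  induction n generalizing x with
  | zero => exact h x
  | succ n ih => exact abs_iteratedDeriv_stepSeq_succ_le ha ih x

lemma abs_iteratedDeriv_stepSeq_diag_le {a : ℕ → ℝ} (ha : ∀ j, 0 < a j) (n : ℕ) (x : ℝ) :
    |iteratedDeriv n (stepSeq a n) x| ≤ ∏ j ∈ Finset.range n, 2 / a j := by
  induction n generalizing x with
  | zero =>
    simp only [iteratedDeriv_zero, stepSeq, Finset.range_zero, Finset.prod_empty]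
    rw [abs_of_nonneg (Real.smoothTransition.nonneg _)]
    exact Real.smoothTransition.le_one _
  | succ n ih =>
    rw [stepSeq, iteratedDeriv_boxAvg _ _ (contDiff_stepSeq a n), Finset.prod_range_succ]
    have h1 : iteratedDeriv (n + 1) (stepSeq a n) = deriv (iteratedDeriv n (stepSeq a n)) :=
      iteratedDeriv_succ
    have h2 : boxAvg (a n) (iteratedDeriv (n + 1) (stepSeq a n)) x =
        (a n)⁻¹ * (iteratedDeriv n (stepSeq a n) (x + a n) - iteratedDeriv n (stepSeq a n) x) := by
      have hc := continuous_iteratedDeriv_stepSeq a n (n + 1)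
      rw [h1] at hc ⊢
      rw [boxAvg, intervalIntegral.integral_deriv_eq_sub (fun y _ =>
        ((contDiff_stepSeq a n).differentiable_iteratedDeriv n (by exact_mod_cast WithTop.coe_lt_top _) y))
        (hc.intervalIntegrable _ _)]
    have h3 := ih (x + a n)
    have h4 := ih x
    rw [h2, abs_mul, abs_of_pos (inv_pos.2 (ha n)), inv_mul_le_iff₀ (ha n)]
    have h5 := abs_sub (iteratedDeriv n (stepSeq a n) (x + a n)) (iteratedDeriv n (stepSeq a n) x)
    have h6 : a n * ((∏ j ∈ Finset.range n, 2 / a j) * (2 / a n)) =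
        2 * ∏ j ∈ Finset.range n, 2 / a j := by have := (ha n).ne'; field_simp
    rw [h6]; linarith

lemma abs_iteratedDeriv_stepSeq_add_le {a : ℕ → ℝ} (ha : ∀ j, 0 < a j) (p n : ℕ) (x : ℝ) :
    |iteratedDeriv p (stepSeq a (p + n)) x| ≤ ∏ j ∈ Finset.range p, 2 / a j := by
  induction n generalizing x with
  | zero => exact abs_iteratedDeriv_stepSeq_diag_le ha p x
  | succ n ih => exact abs_iteratedDeriv_stepSeq_succ_le ha ih x

lemma abs_iteratedDeriv_stepSeq_sub_le {a : ℕ → ℝ} (ha : ∀ j, 0 < a j) {n p : ℕ} {D : ℝ}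
    (h : ∀ x, |iteratedDeriv (p + 1) (stepSeq a 0) x| ≤ D) (x : ℝ) :
    |iteratedDeriv p (stepSeq a (n + 1)) x - iteratedDeriv p (stepSeq a n) x| ≤ a n * D := by
  rw [stepSeq, iteratedDeriv_boxAvg _ _ (contDiff_stepSeq a n)]
  refine abs_boxAvg_sub_le (ha n) (continuous_iteratedDeriv_stepSeq a n p) fun t h1 h2 => ?_
  have hb := abs_iteratedDeriv_stepSeq_le ha h n
  have := Convex.norm_image_sub_le_of_norm_deriv_le (f := iteratedDeriv p (stepSeq a n)) (C := D)
    (s := Set.univ) (x := x) (y := t)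
    (fun y _ => ((contDiff_stepSeq a n).differentiable_iteratedDeriv p (by exact_mod_cast WithTop.coe_lt_top _) y))
    (fun y _ => by rw [← iteratedDeriv_succ]; exact hb y) convex_univ trivial trivial
  refine this.trans ?_
  have hD : 0 ≤ D := (abs_nonneg _).trans (h 0)
  rw [Real.norm_eq_abs, abs_of_nonneg (by linarith), mul_comm]
  exact mul_le_mul_of_nonneg_right (by linarith) hD

/-- The limit of the sequence of moving averages. -/
lemma exists_smooth_step {a : ℕ → ℝ} (ha : ∀ j, 0 < a j) (hs : Summable a)
    (hs' : ∑' j, a j ≤ 1 / 2) : ∃ Φ : ℝ → ℝ, ContDiff ℝ (⊤ : ℕ∞) Φ ∧ (∀ x ≤ 0, Φ x = 0) ∧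
      (∀ x, 1 ≤ x → Φ x = 1) ∧
      ∀ p x, |iteratedDeriv p Φ x| ≤ ∏ j ∈ Finset.range p, 2 / a j := by
  choose D hD using exists_bound_iteratedDeriv_stepSeq_zero a
  set g : ℕ → ℝ → ℝ := fun n x => stepSeq a (n + 1) x - stepSeq a n x with hg
  have hgs : ∀ n, ContDiff ℝ (⊤ : ℕ∞) (g n) := fun n =>
    (contDiff_stepSeq a _).sub (contDiff_stepSeq a _)
  have hgd : ∀ p n x, iteratedDeriv p (g n) x =
      iteratedDeriv p (stepSeq a (n + 1)) x - iteratedDeriv p (stepSeq a n) x := fun p n x =>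
    iteratedDeriv_fun_sub ((contDiff_stepSeq a _).contDiffAt.of_le (mod_cast le_top))
      ((contDiff_stepSeq a _).contDiffAt.of_le (mod_cast le_top))
  have hgb : ∀ p n x, ‖iteratedFDeriv ℝ p (g n) x‖ ≤ a n * D (p + 1) := fun p n x => by
    rw [norm_iteratedFDeriv_eq_norm_iteratedDeriv, hgd, Real.norm_eq_abs]
    exact abs_iteratedDeriv_stepSeq_sub_le ha (hD _) x
  have hsv : ∀ p : ℕ, Summable fun n => a n * D (p + 1) := fun p => hs.mul_right _
  have hG : ContDiff ℝ (⊤ : ℕ∞) (fun x => ∑' n, g n x) :=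
    contDiff_tsum hgs (fun p _ => hsv p) (fun p n x _ => hgb p n x)
  have hlim : ∀ p x, Tendsto (fun n => iteratedDeriv p (stepSeq a n) x) atTop
      (𝓝 (iteratedDeriv p (fun x => stepSeq a 0 x + ∑' n, g n x) x)) := fun p x => by
    rw [iteratedDeriv_fun_add ((contDiff_stepSeq a _).contDiffAt.of_le (mod_cast le_top))
      (hG.contDiffAt.of_le (mod_cast le_top))]
    have h1 : iteratedDeriv p (fun x => ∑' n, g n x) x = ∑' n, iteratedDeriv p (g n) x := by
      have h := iteratedFDeriv_tsum_apply hgs (fun p _ => hsv p) (fun p n x _ => hgb p n x)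
        (k := p) (mod_cast le_top) x
      simp only [iteratedDeriv_eq_iteratedFDeriv]
      rw [h]
      rw [← ContinuousMultilinearMap.tsum_eval]
      exact Summable.of_norm_bounded (hsv p) fun n => hgb p n x
    have hsum : Summable fun n => iteratedDeriv p (g n) x :=
      Summable.of_norm_bounded (hsv p) fun n => by
        rw [← norm_iteratedFDeriv_eq_norm_iteratedDeriv]; exact hgb p n x
    rw [h1]
    have h2 := (hsum.hasSum.tendsto_sum_nat).const_add (iteratedDeriv p (stepSeq a 0) x)
    refine h2.congr fun n => ?_
    simp only [hgd]
    rw [Finset.sum_range_sub (fun n => iteratedDeriv p (stepSeq a n) x)]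
    ring
  have hpart : ∀ n, ∑ j ∈ Finset.range n, a j ≤ 1 / 2 := fun n =>
    (hs.sum_le_tsum _ fun j _ => (ha j).le).trans hs'
  refine ⟨fun x => stepSeq a 0 x + ∑' n, g n x, (contDiff_stepSeq a 0).add hG, fun x hx => ?_,
    fun x hx => ?_, fun p x => ?_⟩
  · refine tendsto_nhds_unique (by simpa using hlim 0 x) (tendsto_const_nhds.congr fun n => ?_)
    exact (stepSeq_of_le ha n (by linarith [hpart n])).symm
  · refine tendsto_nhds_unique (by simpa using hlim 0 x) (tendsto_const_nhds.congr fun n => ?_)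
    exact (stepSeq_of_ge ha n hx).symm
  · refine le_of_tendsto (hlim p x).abs ?_
    filter_upwards [eventually_ge_atTop p] with n hn
    obtain ⟨k, rfl⟩ := Nat.exists_eq_add_of_le hn
    exact abs_iteratedDeriv_stepSeq_add_le ha p k x

/-- A step function of Beurling class. -/
lemma exists_beurling_step {M : ℕ → ℝ} (hM : ∀ p, 0 < M p) (h3 : IsM3' M) :
    ∃ Φ : ℝ → ℝ, ContDiff ℝ (⊤ : ℕ∞) Φ ∧ (∀ x ≤ 0, Φ x = 0) ∧ (∀ x, 1 ≤ x → Φ x = 1) ∧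
      ∀ ε > (0 : ℝ), ∃ C : ℝ, 0 ≤ C ∧ ∀ p x, |iteratedDeriv p Φ x| ≤ C * (ε ^ p * M p) := by
  have hr : ∀ j, 0 < M j / M (j + 1) := fun j => div_pos (hM _) (hM _)
  obtain ⟨v, hv, hv0, hs, hle⟩ := exists_summable_inflation hr h3 (δ := 1 / 2) (by norm_num)
  obtain ⟨Φ, h1, h2, h3, h4⟩ := exists_smooth_step (fun j => div_pos (hr j) (hv j)) hs hle
  refine ⟨Φ, h1, h2, h3, fun ε hε => ?_⟩
  obtain ⟨C, hC, hb⟩ := exists_prod_le_geometric (v := fun j => 2 * v j)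
    (fun j => mul_pos two_pos (hv j)) (by simpa using hv0.const_mul 2) hε
  refine ⟨C / M 0, div_nonneg hC (hM 0).le, fun p x => (h4 p x).trans ?_⟩
  have hprod : ∀ p, ∏ j ∈ Finset.range p, 2 / (M j / M (j + 1) / v j) =
      (∏ j ∈ Finset.range p, 2 * v j) * (M p / M 0) := fun p => by
    induction p with
    | zero => simp [(hM 0).ne']
    | succ p ih =>
      rw [Finset.prod_range_succ, Finset.prod_range_succ, ih]
      have := (hM p).ne'; have := (hM (p + 1)).ne'; have := (hM 0).ne'; have := (hv p).ne'
      field_simp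
  rw [hprod]
  calc _ ≤ C * ε ^ p * (M p / M 0) :=
        mul_le_mul_of_nonneg_right (hb p) (div_nonneg (hM _).le (hM _).le)
    _ = _ := by ring

lemma IsM1.div_le_div_add {M : ℕ → ℝ} (h : IsM1 M) (q p : ℕ) :
    M (q + 1) / M q ≤ M (p + q + 1) / M (p + q) := by
  induction p with
  | zero => simp
  | succ p ih =>
    refine ih.trans ?_
    have h2 := h.2 (p + q + 1) (by omega)
    rw [div_le_div_iff₀ (h.1 _) (h.1 _), show p + 1 + q = p + q + 1 by ring]
    simp only [Nat.add_sub_cancel] at h2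
    nlinarith

lemma IsM1.mul_le {M : ℕ → ℝ} (h : IsM1 M) (p q : ℕ) : M p * M q ≤ M 0 * M (p + q) := by
  induction q with
  | zero => simp [mul_comm]
  | succ q ih =>
    have h1 := h.div_le_div_add q p
    rw [div_le_div_iff₀ (h.1 _) (h.1 _)] at h1
    have h2 := h.1 q
    have h3 := h.1 (p + q)
    have h4 := h.1 (p + q + 1)
    have h5 := h.1 p
    have h6 := h.1 0
    rw [← add_assoc]
    have : M p * M (q + 1) * (M q * M (p + q)) ≤ M 0 * M (p + q + 1) * (M q * M (p + q)) := by
      calc M p * M (q + 1) * (M q * M (p + q)) = (M p * M q) * (M (q + 1) * M (p + q)) := by ring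
        _ ≤ (M 0 * M (p + q)) * (M (p + q + 1) * M q) := by
            apply mul_le_mul ih h1 (by have := h.1 (q + 1); positivity) (by positivity)
        _ = _ := by ring
    exact le_of_mul_le_mul_right this (by positivity)

lemma Beurling.mul {M : ℕ → ℝ} (hM : IsM1 M) {φ ψ : Rd d → ℂ} (hs : Smooth φ) (hs' : Smooth ψ)
    (h : Beurling M φ) (h' : Beurling M ψ) : Beurling M (fun x => φ x * ψ x) := by
  intro ε hε
  obtain ⟨C, hC, hb⟩ := h (ε / 2) (by positivity)
  obtain ⟨C', hC', hb'⟩ := h' (ε / 2) (by positivity)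
  refine ⟨C * C' * M 0, by have := hM.1 0; positivity, fun w x => ?_⟩
  have := norm_wder_mul_le x w hs hs' (U := fun p => C * ((ε / 2) ^ p * M p))
    (V := fun p => C' * ((ε / 2) ^ p * M p))
    (W := fun p => C * C' * M 0 * ((ε / 2) ^ p * M p))
    (fun p => by have := hM.1 p; positivity) (fun v => hb v x) (fun v => hb' v x)
    (fun p q => by
      have := mul_le_mul_of_nonneg_left (hM.mul_le p q)
        (show 0 ≤ C * C' * (ε / 2) ^ (p + q) by positivity)
      rw [pow_add] at this ⊢
      nlinarith)
  refine this.trans (le_of_eq ?_)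
  rw [div_pow]
  field_simp

lemma Beurling.sub {M : ℕ → ℝ} {φ ψ : Rd d → ℂ} (hs : Smooth φ) (hs' : Smooth ψ)
    (h : Beurling M φ) (h' : Beurling M ψ) : Beurling M (fun x => φ x - ψ x) := by
  intro ε hε
  obtain ⟨C, hC, hb⟩ := h ε hε
  obtain ⟨C', hC', hb'⟩ := h' ε hε
  refine ⟨C + C', by positivity, fun w x => ?_⟩
  rw [wder_sub hs hs', add_mul]
  exact (norm_sub_le _ _).trans (add_le_add (hb w x) (hb' w x))

lemma beurling_one {M : ℕ → ℝ} (hM : ∀ p, 0 < M p) : Beurling M (fun _ : Rd d => (1 : ℂ)) := by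
  intro ε hε
  refine ⟨1 / M 0, (one_div_pos.2 (hM 0)).le, fun w x => ?_⟩
  induction w using List.reverseRecOn with
  | nil => simp [(hM 0).ne']
  | append_singleton w i _ =>
    have h0 : pder i (fun _ : Rd d => (1 : ℂ)) = fun _ => 0 := by ext x; simp [pder]
    rw [wder_append, wder_cons, wder_nil, h0, wder_zero, norm_zero]
    have := hM (w ++ [i]).length
    have := hM 0
    positivity

lemma smooth_finset_prod {ι : Type*} (s : Finset ι) {g : ι → Rd d → ℂ} (hs : ∀ i, Smooth (g i)) :
    Smooth (fun x => ∏ i ∈ s, g i x) := contDiff_prod fun i _ => hs i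

lemma beurling_finset_prod {ι : Type*} {M : ℕ → ℝ} (hM : IsM1 M) (s : Finset ι)
    {g : ι → Rd d → ℂ} (hs : ∀ i, Smooth (g i)) (h : ∀ i, Beurling M (g i)) :
    Beurling M (fun x => ∏ i ∈ s, g i x) := by
  classical
  induction s using Finset.induction_on with
  | empty => simpa using beurling_one hM.1
  | insert i s hi ih =>
    simp only [Finset.prod_insert hi]
    exact (h i).mul hM (hs i) (smooth_finset_prod s hs) ih

lemma smooth_coord {g : ℝ → ℝ} (hg : ContDiff ℝ (⊤ : ℕ∞) g) (c b : ℝ) (i : Fin d) :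
    Smooth (fun x : Rd d => ((g (c * x i + b) : ℝ) : ℂ)) := by
  refine Complex.ofRealCLM.contDiff.comp (hg.comp ?_)
  exact (contDiff_const.mul (EuclideanSpace.proj (𝕜 := ℝ) i).contDiff).add contDiff_const

lemma pder_coord {g : ℝ → ℝ} (hg : ContDiff ℝ (⊤ : ℕ∞) g) (c b : ℝ) (i j : Fin d) :
    pder j (fun x : Rd d => ((g (c * x i + b) : ℝ) : ℂ)) =
      fun x => (if i = j then (c : ℂ) else 0) * ((deriv g (c * x i + b) : ℝ) : ℂ) := by
  ext x
  have hg' : HasDerivAt g (deriv g (c * x i + b)) (c * x i + b) :=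
    ((contDiff_infty_iff_deriv.1 hg).1 _).hasDerivAt
  have h1 : HasFDerivAt (fun x : Rd d => c * x i + b)
      (c • (EuclideanSpace.proj i : Rd d →L[ℝ] ℝ)) x :=
    ((EuclideanSpace.proj (𝕜 := ℝ) i : Rd d →L[ℝ] ℝ).hasFDerivAt.const_mul c).add_const b
  have h2 := Complex.ofRealCLM.hasFDerivAt.comp x (hg'.comp_hasFDerivAt x h1)
  have h3 : fderiv ℝ (fun x : Rd d => ((g (c * x i + b) : ℝ) : ℂ)) x = _ := h2.fderiv
  simp only [pder, h3]
  by_cases h : i = j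
  · subst h; simp [mul_comm]
  · simp [h]

lemma norm_wder_coord_le (w : List (Fin d)) (c b : ℝ) (i : Fin d) : ∀ {g : ℝ → ℝ},
    ContDiff ℝ (⊤ : ℕ∞) g → ∀ {U : ℕ → ℝ}, (∀ p x, |iteratedDeriv p g x| ≤ U p) → ∀ x,
    ‖wder w (fun x : Rd d => ((g (c * x i + b) : ℝ) : ℂ)) x‖ ≤ |c| ^ w.length * U w.length := by
  induction w using List.reverseRecOn with
  | nil => intro g hg U hU x; simpa using hU 0 _
  | append_singleton w j ih =>
    intro g hg U hU x
    have hd := (contDiff_infty_iff_deriv.1 hg).2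
    have h := ih hd (U := fun p => U (p + 1)) (fun p x => by
      rw [← iteratedDeriv_succ']; exact hU _ _) x
    rw [wder_append, wder_cons, wder_nil, pder_coord hg, wder_const_mul _ (smooth_coord hd _ _ _),
      norm_mul, List.length_append, List.length_singleton, pow_succ]
    have h0 : 0 ≤ |c| ^ w.length * U (w.length + 1) := (norm_nonneg _).trans h
    split_ifs with hij
    · rw [Complex.norm_real, Real.norm_eq_abs]
      nlinarith [abs_nonneg c]
    · rw [norm_zero, zero_mul]
      nlinarith [mul_nonneg (abs_nonneg c) h0]

lemma beurling_coord {M : ℕ → ℝ} {g : ℝ → ℝ} (hg : ContDiff ℝ (⊤ : ℕ∞) g)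
    (h : ∀ ε > (0 : ℝ), ∃ C : ℝ, 0 ≤ C ∧ ∀ p x, |iteratedDeriv p g x| ≤ C * (ε ^ p * M p))
    {c : ℝ} (hc : 0 < c) (b : ℝ) (i : Fin d) :
    Beurling M (fun x : Rd d => ((g (c * x i + b) : ℝ) : ℂ)) := by
  intro ε hε
  obtain ⟨C, hC, hb⟩ := h (ε / c) (by positivity)
  refine ⟨C, hC, fun w x => (norm_wder_coord_le w c b i hg hb x).trans (le_of_eq ?_)⟩
  rw [abs_of_pos hc, div_pow]
  field_simp

/-- The closed cube `[a, b]^d`. -/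
def cbox (a b : ℝ) : Set (Rd d) := {x | ∀ i, x i ∈ Set.Icc a b}

lemma isCompact_cbox (a b : ℝ) : IsCompact (cbox a b : Set (Rd d)) := by
  have h : IsCompact (Set.pi Set.univ fun _ : Fin d => Set.Icc a b) :=
    isCompact_univ_pi fun _ => isCompact_Icc
  convert h.image (PiLp.continuous_toLp 2 (fun _ : Fin d => ℝ)) using 1
  ext x
  constructor
  · exact fun hx => ⟨WithLp.ofLp x, fun i _ => hx i, rfl⟩
  · rintro ⟨y, hy, rfl⟩
    exact fun i => hy i trivial

/-- The points of the lattice `(ℤ/8)^d`. -/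
def latt (n : Fin d → ℤ) : Rd d := WithLp.toLp 2 fun i => (n i : ℝ) / 8

@[simp] lemma latt_apply (n : Fin d → ℤ) (i : Fin d) : latt n i = (n i : ℝ) / 8 := rfl

/-- A product of differences of steps, of width comparable to `1/8`. -/
def window (Φ : ℝ → ℝ) (a b : ℝ) (x : Rd d) : ℂ :=
  ∏ i, (((Φ (8 * x i + -a) : ℝ) : ℂ) - ((Φ (8 * x i + -b) : ℝ) : ℂ))

lemma window_eq_zero {Φ : ℝ → ℝ} (h0 : ∀ x ≤ 0, Φ x = 0) (h1 : ∀ x, 1 ≤ x → Φ x = 1) {a b : ℝ}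
    (hab : a ≤ b) {x : Rd d} (hx : x ∉ cbox (a / 8) ((b + 1) / 8)) : window Φ a b x = 0 := by
  simp only [cbox, Set.mem_ofPred_eq, not_forall, Set.mem_Icc, not_and_or, not_le] at hx
  obtain ⟨i, hi⟩ := hx
  refine Finset.prod_eq_zero (Finset.mem_univ i) ?_
  rcases hi with hi | hi
  · rw [h0 _ (by linarith), h0 _ (by linarith), sub_self]
  · rw [h1 _ (by linarith), h1 _ (by linarith), sub_self]

lemma tsupport_window_subset {Φ : ℝ → ℝ} (h0 : ∀ x ≤ 0, Φ x = 0) (h1 : ∀ x, 1 ≤ x → Φ x = 1)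
    {a b : ℝ} (hab : a ≤ b) :
    tsupport (window Φ a b : Rd d → ℂ) ⊆ cbox (a / 8) ((b + 1) / 8) :=
  closure_minimal (fun _ hx => by_contra fun h => hx (window_eq_zero h0 h1 hab h))
    (isCompact_cbox _ _).isClosed

lemma window_eq_one {Φ : ℝ → ℝ} (h0 : ∀ x ≤ 0, Φ x = 0) (h1 : ∀ x, 1 ≤ x → Φ x = 1) {a b : ℝ}
    {x : Rd d} (hx : x ∈ cbox ((a + 1) / 8) (b / 8)) : window Φ a b x = 1 := by
  refine Finset.prod_eq_one fun i _ => ?_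
  rw [h1 _ (by linarith [(hx i).1]), h0 _ (by linarith [(hx i).2])]
  simp

lemma isTestD_window {M : ℕ → ℝ} (hM : IsM1 M) {Φ : ℝ → ℝ} (hs : ContDiff ℝ (⊤ : ℕ∞) Φ)
    (h0 : ∀ x ≤ 0, Φ x = 0) (h1 : ∀ x, 1 ≤ x → Φ x = 1)
    (h : ∀ ε > (0 : ℝ), ∃ C : ℝ, 0 ≤ C ∧ ∀ p x, |iteratedDeriv p Φ x| ≤ C * (ε ^ p * M p))
    {a b : ℝ} (hab : a ≤ b) : IsTestD M (window Φ a b : Rd d → ℂ) := by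
  rw [isTestD_iff hM.1]
  have hs1 : ∀ i, Smooth (fun x : Rd d =>
      ((Φ (8 * x i + -a) : ℝ) : ℂ) - ((Φ (8 * x i + -b) : ℝ) : ℂ)) := fun i =>
    (smooth_coord hs _ _ i).sub (smooth_coord hs _ _ i)
  refine ⟨smooth_finset_prod _ hs1,
    (isCompact_cbox _ _).of_isClosed_subset (isClosed_tsupport _)
      (tsupport_window_subset h0 h1 hab), beurling_finset_prod hM _ hs1 fun i => ?_⟩
  exact (beurling_coord hs h (by norm_num) _ i).sub (smooth_coord hs _ _ i)
    (smooth_coord hs _ _ i) (beurling_coord hs h (by norm_num) _ i)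

lemma sum_window_translates {Φ : ℝ → ℝ} (h0 : ∀ x ≤ 0, Φ x = 0) (h1 : ∀ x, 1 ≤ x → Φ x = 1)
    {a : ℝ} {N : ℕ} {x : Rd d} (hx : ∀ i, |8 * x i - a| + 1 ≤ N) :
    ∑ n ∈ Fintype.piFinset fun _ : Fin d => Finset.Ico (-N : ℤ) N,
      window Φ a (a + 1) (x - latt n) = 1 := by
  have hsum : ∀ (m : ℕ) (y : ℝ), ∑ k ∈ Finset.Ico (-N : ℤ) (-N + m),
      (Φ (y - k) - Φ (y - k - 1)) = Φ (y + N) - Φ (y + N - m) := fun m y => by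
    induction m with
    | zero => simp
    | succ m ih =>
      have : Finset.Ico (-N : ℤ) (-N + (m + 1 : ℕ)) =
          insert (-N + m : ℤ) (Finset.Ico (-N : ℤ) (-N + m)) := by
        ext k; simp only [Finset.mem_insert, Finset.mem_Ico]; push_cast; omega
      rw [this, Finset.sum_insert (by simp), ih]
      push_cast
      rw [show y - (-(N : ℝ) + m) = y + N - m by ring,
        show y + (N : ℝ) - (m + 1) = y + N - m - 1 by ring]
      ring
  simp only [window]
  have := Finset.prod_univ_sum (fun _ : Fin d => Finset.Ico (-N : ℤ) N)
    (fun i k => ((Φ (8 * (x i - (k : ℝ) / 8) + -a) : ℝ) : ℂ) -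
      ((Φ (8 * (x i - (k : ℝ) / 8) + -(a + 1)) : ℝ) : ℂ))
  refine Eq.trans this.symm (Finset.prod_eq_one fun i _ => ?_)
  have h2 := hsum (2 * N) (8 * x i - a)
  rw [show (-(N : ℤ) + (2 * N : ℕ)) = N by push_cast; ring] at h2
  have h3 := abs_le.1 (show |8 * x i - a| ≤ N - 1 by linarith [hx i])
  rw [h1 _ (by linarith), h0 _ (by push_cast; linarith), sub_zero] at h2
  refine Eq.trans ?_ ((congrArg Complex.ofReal h2).trans Complex.ofReal_one)
  push_cast
  refine Finset.sum_congr rfl fun k _ => ?_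
  congr 3 <;> ring

/-- A partition of unity of Beurling class along `(ℤ/8)^d`, subordinate to cubes, together with a
plateau function on the cube of the partition. -/
lemma exists_windows {M : ℕ → ℝ} (hM : IsM1 M) (h3 : IsM3' M) :
    ∃ χ η : Rd d → ℂ, IsTestD M χ ∧ IsTestD M η ∧ tsupport χ ⊆ cbox (3 / 8) (5 / 8) ∧
      tsupport η ⊆ cbox (1 / 8) (7 / 8) ∧ (∀ x ∈ cbox (3 / 8) (5 / 8), η x = 1) ∧
      ∀ (N : ℕ) (x : Rd d), (∀ i, |8 * x i - 3| + 1 ≤ N) →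
        ∑ n ∈ Fintype.piFinset fun _ : Fin d => Finset.Ico (-N : ℤ) N, χ (x - latt n) = 1 := by
  obtain ⟨Φ, hs, h0, h1, hb⟩ := exists_beurling_step hM.1 h3
  refine ⟨window Φ 3 (3 + 1), window Φ 1 6, isTestD_window hM hs h0 h1 hb (by norm_num),
    isTestD_window hM hs h0 h1 hb (by norm_num), ?_, ?_, fun x hx => ?_,
    fun N x hx => sum_window_translates h0 h1 hx⟩
  · convert tsupport_window_subset (d := d) h0 h1 (show (3 : ℝ) ≤ 3 + 1 by norm_num) using 2
    norm_num
  · convert tsupport_window_subset (d := d) h0 h1 (show (1 : ℝ) ≤ 6 by norm_num) using 2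
    norm_num
  · refine window_eq_one h0 h1 fun i => ⟨?_, ?_⟩
    · linarith [(hx i).1]
    · linarith [(hx i).2]

/-- The character `x ↦ e^{2πi k·x}`. -/
def echar (k : Fin d → ℤ) (x : Rd d) : ℂ := Complex.exp (∑ i, (2 * π * Complex.I * k i) * x i)

lemma norm_echar (k : Fin d → ℤ) (x : Rd d) : ‖echar k x‖ = 1 := by
  have h : (∑ i, (2 * π * Complex.I * k i) * x i : ℂ) =
      ((∑ i, 2 * π * k i * x i : ℝ) : ℂ) * Complex.I := by
    push_cast; rw [Finset.sum_mul]; exact Finset.sum_congr rfl fun i _ => by ring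
  rw [echar, h, Complex.norm_exp_ofReal_mul_I]

lemma smooth_echar (k : Fin d → ℤ) : Smooth (echar k) := by
  refine ContDiff.cexp (ContDiff.sum fun i _ => contDiff_const.mul ?_)
  exact Complex.ofRealCLM.contDiff.comp (EuclideanSpace.proj (𝕜 := ℝ) i).contDiff

lemma pder_echar (k : Fin d → ℤ) (j : Fin d) :
    pder j (echar k) = fun x => (2 * π * Complex.I * k j) * echar k x := by
  ext x
  have h1 : ∀ i, HasFDerivAt (fun x : Rd d => (2 * π * Complex.I * k i) * ((x i : ℝ) : ℂ))
      ((2 * π * Complex.I * k i) •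
        (Complex.ofRealCLM.comp (EuclideanSpace.proj i : Rd d →L[ℝ] ℝ))) x := fun i =>
    ((Complex.ofRealCLM.comp (EuclideanSpace.proj i : Rd d →L[ℝ] ℝ)).hasFDerivAt).const_mul _
  have h2 : HasFDerivAt (echar k) _ x := (HasFDerivAt.fun_sum fun i _ => h1 i).cexp
  rw [pder, h2.fderiv]
  have h3 : ∀ (c : Fin d → ℂ), (∑ i, c i • (Complex.ofRealCLM ∘SL
      (EuclideanSpace.proj i : Rd d →L[ℝ] ℝ))) (EuclideanSpace.single j 1) = c j := fun c => by
    rw [sum_apply, Finset.sum_eq_single j]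
    · simp
    · intro i _ hij; simp [hij]
    · simp
  rw [smul_apply, h3, smul_eq_mul, mul_comm, echar]

lemma wder_echar (k : Fin d → ℤ) (w : List (Fin d)) :
    wder w (echar k) = fun x => (w.map fun j => (2 * π * Complex.I * k j : ℂ)).prod * echar k x := by
  induction w with
  | nil => simp
  | cons i w ih =>
    rw [wder_cons, ih, pder_const_mul _ (smooth_echar k), pder_echar]
    ext x; simp; ring

/-- The size `2π max |k i|` of a frequency. -/
def freq (k : Fin d → ℤ) : ℝ := 2 * π * ‖k‖

lemma freq_nonneg (k : Fin d → ℤ) : 0 ≤ freq k := by unfold freq; positivity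

lemma norm_symbol_le_freq (k : Fin d → ℤ) (j : Fin d) :
    ‖(2 * π * Complex.I * k j : ℂ)‖ ≤ freq k := by
  have h := norm_le_pi_norm k j
  rw [Int.norm_eq_abs] at h
  simp only [norm_mul, Complex.norm_I, mul_one, Complex.norm_intCast, Complex.norm_real,
    Complex.norm_ofNat, Real.norm_eq_abs, abs_of_pos pi_pos, freq]
  gcongr

lemma norm_wder_echar_le (k : Fin d → ℤ) (w : List (Fin d)) (x : Rd d) :
    ‖wder w (echar k) x‖ ≤ freq k ^ w.length := by
  rw [wder_echar, norm_mul, norm_echar, mul_one]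
  induction w with
  | nil => simp
  | cons i w ih =>
    rw [List.map_cons, List.prod_cons, norm_mul, List.length_cons, pow_succ']
    exact mul_le_mul (norm_symbol_le_freq k i) ih (norm_nonneg _) (freq_nonneg k)

/-- A coordinate at which a frequency attains its size. -/
lemma exists_norm_symbol_eq_freq {k : Fin d → ℤ} (hk : k ≠ 0) :
    ∃ i, ‖(2 * π * Complex.I * k i : ℂ)‖ = freq k := by
  obtain ⟨j, -⟩ := Function.ne_iff.1 hk
  have : Nonempty (Fin d) := ⟨j⟩
  obtain ⟨i, -, hi⟩ := Finset.exists_max_image Finset.univ (fun i => ‖k i‖) Finset.univ_nonempty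
  refine ⟨i, le_antisymm (norm_symbol_le_freq k i) ?_⟩
  have h : ‖k‖ ≤ ‖k i‖ := (pi_norm_le_iff_of_nonneg (norm_nonneg _)).2 fun j => hi j (by simp)
  rw [Int.norm_eq_abs] at h
  simp only [norm_mul, Complex.norm_I, mul_one, Complex.norm_intCast, Complex.norm_real,
    Complex.norm_ofNat, Real.norm_eq_abs, abs_of_pos pi_pos, freq]
  gcongr

/-- The Fourier coefficients of a function supported in the unit cube. -/
def fcoeff (ψ : Rd d → ℂ) (k : Fin d → ℤ) : ℂ := ∫ x, ψ x * echar (-k) x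

lemma integrable_mul_echar {ψ : Rd d → ℂ} (hψ : Continuous ψ) (hc : HasCompactSupport ψ)
    (k : Fin d → ℤ) : Integrable fun x => ψ x * echar k x :=
  (hψ.mul (smooth_echar k).continuous).integrable_of_hasCompactSupport hc.mul_right

lemma HasCompactSupport.pder {ψ : Rd d → ℂ} (hc : HasCompactSupport ψ) (i : Fin d) :
    HasCompactSupport (pder i ψ) :=
  hc.of_isClosed_subset (isClosed_tsupport _) (tsupport_pder_subset ψ i)

lemma HasCompactSupport.wder {ψ : Rd d → ℂ} (hc : HasCompactSupport ψ) (w : List (Fin d)) :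
    HasCompactSupport (wder w ψ) :=
  hc.of_isClosed_subset (isClosed_tsupport _) (tsupport_wder_subset ψ w)

lemma fcoeff_pder {ψ : Rd d → ℂ} (hψ : Smooth ψ) (hc : HasCompactSupport ψ) (i : Fin d)
    (k : Fin d → ℤ) : fcoeff (pder i ψ) k = (2 * π * Complex.I * k i) * fcoeff ψ k := by
  have h1 : Integrable fun x => ψ x * pder i (echar (-k)) x := by
    rw [pder_echar]
    simp_rw [mul_left_comm (ψ _)]
    exact (integrable_mul_echar hψ.continuous hc (-k)).const_mul _
  have := integral_mul_fderiv_eq_neg_fderiv_mul_of_integrable (μ := volume) (f := ψ)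
    (g := echar (-k)) (v := EuclideanSpace.single i 1)
    (integrable_mul_echar (hψ.pder i).continuous (HasCompactSupport.pder hc i) (-k)) h1
    (integrable_mul_echar hψ.continuous hc (-k)) (fun x _ => hψ.differentiable x)
    (fun x _ => (smooth_echar (-k)).differentiable x)
  have h2 : ∀ x, ψ x * fderiv ℝ (echar (-k)) x (EuclideanSpace.single i 1) =
      -(2 * π * Complex.I * k i) * (ψ x * echar (-k) x) := fun x => by
    have := congrFun (pder_echar (-k) i) x
    simp only [pder] at this
    rw [this]; simp; ring
  simp_rw [h2] at this
  rw [integral_const_mul, neg_mul, neg_inj] at this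
  exact this.symm

lemma fcoeff_wder_replicate {ψ : Rd d → ℂ} (hψ : Smooth ψ) (hc : HasCompactSupport ψ) (i : Fin d)
    (k : Fin d → ℤ) (m : ℕ) :
    fcoeff (wder (List.replicate m i) ψ) k = (2 * π * Complex.I * k i) ^ m * fcoeff ψ k := by
  induction m with
  | zero => simp
  | succ m ih =>
    rw [List.replicate_succ, wder_cons, fcoeff_pder (hψ.wder _) (HasCompactSupport.wder hc _), ih]
    ring

/-- The periodisation of a function supported in the unit cube. -/
def toTorus (ψ : Rd d → ℂ) (t : UnitAddTorus (Fin d)) : ℂ :=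
  ψ (WithLp.toLp 2 fun i => (AddCircle.equivIoc 1 0 (t i) : ℝ))

lemma toTorus_coe (ψ : Rd d → ℂ) {x : Fin d → ℝ} (hx : ∀ i, x i ∈ Set.Ioc (0 : ℝ) (0 + 1)) :
    toTorus ψ (fun i => (x i : UnitAddCircle)) = ψ (WithLp.toLp 2 x) := by
  unfold toTorus
  congr 2
  ext i
  rw [AddCircle.equivIoc_coe_eq (hx i)]

lemma continuous_toTorus {ψ : Rd d → ℂ} (hψ : Continuous ψ)
    (hs : ∀ x, x ∉ cbox (1 / 8) (7 / 8) → ψ x = 0) : Continuous (toTorus ψ) := by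
  set A : Set UnitAddCircle := (fun x : ℝ => (x : UnitAddCircle)) '' Set.Icc (1 / 8) (7 / 8)
  have hA : IsClosed A := (isCompact_Icc.image (AddCircle.continuous_mk' 1)).isClosed
  rw [continuous_iff_continuousAt]
  intro t
  by_cases ht : ∀ i, t i ∈ A
  · refine hψ.continuousAt.comp ((PiLp.continuous_toLp 2 _).continuousAt.comp ?_)
    refine continuousAt_pi.2 fun i => continuous_subtype_val.continuousAt.comp ?_
    have hne : t i ≠ ((0 : ℝ) : UnitAddCircle) := by
      obtain ⟨y, hy, hyt⟩ := ht i
      intro h0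
      have h1 := AddCircle.equivIco_coe_eq (p := (1 : ℝ)) (a := 0) (x := y)
        ⟨by linarith [hy.1], by linarith [hy.2]⟩
      have h2 := AddCircle.equivIco_coe_eq (p := (1 : ℝ)) (a := 0) (x := 0) (by simp)
      have h3 : ((y : ℝ) : UnitAddCircle) = ((0 : ℝ) : UnitAddCircle) := hyt.trans h0
      rw [h3, h2] at h1
      have := congrArg Subtype.val h1
      simp only at this
      linarith [hy.1]
    exact ContinuousAt.comp (f := fun s : UnitAddTorus (Fin d) => s i)
      (AddCircle.continuousAt_equivIoc 1 0 hne) (continuous_apply i).continuousAt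
  · push Not at ht
    obtain ⟨i, hi⟩ := ht
    have hev : toTorus ψ =ᶠ[nhds t] fun _ => 0 := by
      filter_upwards [(hA.isOpen_compl.preimage
        (f := fun s : UnitAddTorus (Fin d) => s i) (continuous_apply i)).mem_nhds hi] with s hs'
      refine hs _ fun hb => hs' ⟨_, hb i, ?_⟩
      exact AddCircle.coe_equivIoc
    exact continuousAt_const.congr hev.symm

lemma mFourier_coe (k : Fin d → ℤ) (x : Fin d → ℝ) :
    UnitAddTorus.mFourier k (fun i => (x i : UnitAddCircle)) = echar k (WithLp.toLp 2 x) := by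
  rw [UnitAddTorus.mFourier, echar, Complex.exp_sum]
  simp only [ContinuousMap.coe_mk, fourier_coe_apply]
  exact Finset.prod_congr rfl fun i _ => by simp

lemma mFourierCoeff_toTorus {ψ : Rd d → ℂ} (hs : ∀ x, x ∉ cbox (1 / 8) (7 / 8) → ψ x = 0)
    (k : Fin d → ℤ) : UnitAddTorus.mFourierCoeff (toTorus ψ) k = fcoeff ψ k := by
  rw [UnitAddTorus.mFourierCoeff_eq_integral _ _ 0]
  have hmeas : MeasurableSet {x : Fin d → ℝ | ∀ i, x i ∈ Set.Ioc ((0 : Fin d → ℝ) i)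
      ((0 : Fin d → ℝ) i + 1)} := MeasurableSet.univ_pi' fun i => measurableSet_Ioc
  have h1 := setIntegral_congr_fun (μ := volume) hmeas (f := fun x : Fin d → ℝ =>
    UnitAddTorus.mFourier (-k) (fun i => (x i : UnitAddCircle)) •
      toTorus ψ (fun i => (x i : UnitAddCircle)))
    (g := fun x => ψ (WithLp.toLp 2 x) * echar (-k) (WithLp.toLp 2 x)) (fun x hx => by
      simp only [mFourier_coe, smul_eq_mul]
      rw [toTorus_coe ψ (fun i => hx i), mul_comm])
  rw [h1, setIntegral_eq_integral_of_forall_compl_eq_zero]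
  · exact (EuclideanSpace.volume_preserving_symm_measurableEquiv_toLp (Fin d)).symm.integral_comp'
      (fun x => ψ x * echar (-k) x)
  · intro x hx
    rw [hs, zero_mul]
    intro hb
    exact hx fun i => ⟨by have := (hb i).1; simp at this ⊢; linarith,
      by have := (hb i).2; simp at this ⊢; linarith⟩

lemma hasSum_fcoeff {ψ : Rd d → ℂ} (hψ : Continuous ψ)
    (hs : ∀ x, x ∉ cbox (1 / 8) (7 / 8) → ψ x = 0) (hsum : Summable (fcoeff ψ)) {x : Rd d}
    (hx : x ∈ cbox (1 / 8) (7 / 8)) : HasSum (fun k => fcoeff ψ k * echar k x) (ψ x) := by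
  have h := UnitAddTorus.hasSum_mFourier_series_apply_of_summable
    (f := ⟨toTorus ψ, continuous_toTorus hψ hs⟩) (by
      simpa only [ContinuousMap.coe_mk, funext (mFourierCoeff_toTorus hs)] using hsum)
    (fun i => ((x i : ℝ) : UnitAddCircle))
  simp only [ContinuousMap.coe_mk, mFourierCoeff_toTorus hs, mFourier_coe, smul_eq_mul] at h
  rw [toTorus_coe] at h
  · exact h
  · exact fun i => ⟨by linarith [(hx i).1], by linarith [(hx i).2]⟩

lemma summable_pi_prod {ι : Type*} {f : ι → ℝ} (h0 : ∀ i, 0 ≤ f i) (hf : Summable f) :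
    Summable fun k : Fin d → ι => ∏ i, f (k i) := by
  classical
  refine summable_of_sum_le (c := (∑' i, f i) ^ d)
    (fun k => Finset.prod_nonneg fun i _ => h0 _) fun s => ?_
  have hsub : s ⊆ Fintype.piFinset fun i => s.image fun k => k i := fun k hk =>
    Fintype.mem_piFinset.2 fun i => Finset.mem_image_of_mem _ hk
  calc ∑ k ∈ s, ∏ i, f (k i)
      ≤ ∑ k ∈ Fintype.piFinset fun i => s.image fun k => k i, ∏ i, f (k i) :=
        Finset.sum_le_sum_of_subset_of_nonneg hsub
          fun k _ _ => Finset.prod_nonneg fun i _ => h0 _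
    _ = ∏ i, ∑ j ∈ s.image fun k => k i, f j := (Finset.prod_univ_sum _ _).symm
    _ ≤ ∏ _i : Fin d, ∑' i, f i := Finset.prod_le_prod
        (fun i _ => Finset.sum_nonneg fun j _ => h0 j) fun i _ => hf.sum_le_tsum _ fun j _ => h0 j
    _ = (∑' i, f i) ^ d := by simp

/-- A summable family of weights on frequencies. -/
def lam (k : Fin d → ℤ) : ℝ := ∏ i, (max 1 |(k i : ℝ)|) ^ (-2 : ℤ)

lemma lam_pos (k : Fin d → ℤ) : 0 < lam k := Finset.prod_pos fun i _ => by positivity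

lemma lam_zero : lam (0 : Fin d → ℤ) = 1 := by simp [lam]

lemma summable_lam : Summable (lam : (Fin d → ℤ) → ℝ) := by
  refine summable_pi_prod (f := fun n : ℤ => (max 1 |(n : ℝ)|) ^ (-2 : ℤ))
    (fun n => by positivity) ?_
  refine (Real.summable_one_div_int_pow (p := 2).2 (by norm_num)).of_norm_bounded_eventually ?_
  rw [Int.cofinite_eq]
  have h : ∀ n : ℤ, n ≠ 0 → ‖(max 1 |(n : ℝ)|) ^ (-2 : ℤ)‖ ≤ 1 / (n : ℝ) ^ 2 := fun n hn => by
    have h1 : 1 ≤ |(n : ℝ)| := by exact_mod_cast Int.one_le_abs hn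
    rw [max_eq_right h1, norm_zpow, Real.norm_eq_abs, abs_abs, zpow_neg, one_div]
    have h2 : |(n : ℝ)| ^ (2 : ℤ) = (n : ℝ) ^ 2 := by
      rw [show (2 : ℤ) = ((2 : ℕ) : ℤ) from rfl, zpow_natCast, sq_abs]
    rw [h2]
  exact (eventually_sup.2 ⟨(eventually_lt_atBot 0).mono fun n hn => h n hn.ne,
    (eventually_gt_atTop 0).mono fun n hn => h n hn.ne'⟩)

lemma one_le_freq {k : Fin d → ℤ} (hk : k ≠ 0) : 1 ≤ ‖k‖ ∧ ‖k‖ ≤ freq k := by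
  obtain ⟨j, hj⟩ := Function.ne_iff.1 hk
  have h1 : 1 ≤ ‖k j‖ := by
    rw [Int.norm_eq_abs]; exact_mod_cast Int.one_le_abs hj
  have h2 : 1 ≤ ‖k‖ := h1.trans (norm_le_pi_norm k j)
  refine ⟨h2, ?_⟩
  rw [freq]
  exact le_mul_of_one_le_left (by positivity) (by nlinarith [pi_gt_three])

lemma inv_freq_pow_le_lam {k : Fin d → ℤ} (hk : k ≠ 0) : (freq k ^ (2 * d))⁻¹ ≤ lam k := by
  obtain ⟨h1, h2⟩ := one_le_freq hk
  have h3 : ∏ i, (max 1 |(k i : ℝ)|) ^ 2 ≤ freq k ^ (2 * d) := by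
    calc ∏ i, (max 1 |(k i : ℝ)|) ^ 2 ≤ ∏ _i : Fin d, freq k ^ 2 := by
          refine Finset.prod_le_prod (fun i _ => by positivity) fun i _ => ?_
          have h4 := norm_le_pi_norm k i
          rw [Int.norm_eq_abs] at h4
          exact pow_le_pow_left₀ (by positivity) (max_le (h1.trans h2) (h4.trans h2)) 2
      _ = freq k ^ (2 * d) := by simp [pow_mul]
  have h5 : lam k = (∏ i, (max 1 |(k i : ℝ)|) ^ 2)⁻¹ := by
    rw [lam, ← Finset.prod_inv_distrib]
    exact Finset.prod_congr rfl fun i _ => by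
      rw [show (-2 : ℤ) = -((2 : ℕ) : ℤ) from rfl, zpow_neg, zpow_natCast]
  rw [h5]
  exact inv_anti₀ (Finset.prod_pos fun i _ => by positivity) h3

lemma IsM2'.iterate {M : ℕ → ℝ} (h : IsM2' M) (r : ℕ) :
    ∃ A H : ℝ, 1 ≤ A ∧ 1 ≤ H ∧ ∀ p, M (p + r) ≤ A * H ^ p * M p := by
  obtain ⟨A, H, hA, hH, hb⟩ := h
  induction r with
  | zero => exact ⟨1, 1, le_rfl, le_rfl, fun p => by simp⟩
  | succ r ih =>
    obtain ⟨A', H', hA', hH', hb'⟩ := ih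
    refine ⟨A * H ^ r * A', H * H', ?_, one_le_mul_of_one_le_of_one_le hH hH', fun p => ?_⟩
    · exact one_le_mul_of_one_le_of_one_le
        (one_le_mul_of_one_le_of_one_le hA (one_le_pow₀ hH)) hA'
    · rw [← add_assoc]
      calc M (p + r + 1) ≤ A * H ^ (p + r) * M (p + r) := hb _
        _ ≤ A * H ^ (p + r) * (A' * H' ^ p * M p) :=
            mul_le_mul_of_nonneg_left (hb' p) (by positivity)
        _ = _ := by rw [pow_add, mul_pow]; ring

lemma exists_forall_le_of_tendsto_zero {x : ℕ → ℝ} (h0 : 0 < x 0) (h : Tendsto x atTop (𝓝 0)) :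
    ∃ p, ∀ q, x q ≤ x p := by
  obtain ⟨N, hN⟩ := eventually_atTop.1 (h.eventually_le_const h0)
  obtain ⟨p, -, hp⟩ := Finset.exists_max_image (Finset.range (N + 1)) x ⟨0, by simp⟩
  refine ⟨p, fun q => ?_⟩
  rcases le_total q N with hq | hq
  · exact hp q (Finset.mem_range.2 (by omega))
  · exact (hN q hq).trans (hp 0 (by simp))

lemma IsM3'.exists_argmax {M : ℕ → ℝ} (hM : ∀ p, 0 < M p) (h : IsM3' M) {c : ℝ} (hc : 0 < c) :
    ∃ p, ∀ q, c ^ q / M q ≤ c ^ p / M p := by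
  refine exists_forall_le_of_tendsto_zero (by have := hM 0; positivity) ?_
  refine (summable_of_ratio_test_tendsto_lt_one (l := 0) one_pos
    (Eventually.of_forall fun n => (div_pos (pow_pos hc n) (hM n)).ne') ?_).tendsto_atTop_zero
  have h1 : ∀ n, ‖c ^ (n + 1) / M (n + 1)‖ / ‖c ^ n / M n‖ = c * (M n / M (n + 1)) := fun n => by
    have := hM n; have := hM (n + 1)
    rw [Real.norm_of_nonneg (by positivity), Real.norm_of_nonneg (by positivity), pow_succ]
    field_simp
  simp_rw [h1]
  simpa using (Summable.tendsto_atTop_zero h).const_mul c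

/-- For every frequency there is a derivative, adapted to the weight sequence, by which one may
integrate by parts so as to beat the growth of the derivatives of the character. -/
lemma exists_frequency_data {M : ℕ → ℝ} (h1 : IsM1 M) (h2 : IsM2' M) (h3 : IsM3' M) {s : ℝ}
    (hs : 0 < s) : ∃ t ≥ (1 : ℝ), ∃ C > (0 : ℝ), ∀ k : Fin d → ℤ,
      ∃ (u : List (Fin d)) (E : ℝ) (z : ℂ), 0 < E ∧ (∀ q, freq k ^ q ≤ E * (s ^ q * M q)) ∧
        ‖z‖ * E ≤ C * lam k * (t ^ u.length / M u.length) ∧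
        ∀ ψ : Rd d → ℂ, Smooth ψ → HasCompactSupport ψ →
          fcoeff ψ k = z * fcoeff (wder u ψ) k := by
  obtain ⟨A, H, hA, hH, hb⟩ := h2.iterate (2 * d)
  have hM := h1.1
  refine ⟨max 1 (H / s), le_max_left _ _, A, by linarith, fun k => ?_⟩
  by_cases hk : k = 0
  · subst hk
    have hM0 := hM 0
    refine ⟨[], 1 / M 0, 1, by positivity, fun q => ?_, ?_, fun ψ _ _ => by simp⟩
    · rcases q with _ | q
      · simp [hM0.ne']
      · have := hM (q + 1)
        simp only [freq, norm_zero, mul_zero, ne_eq, Nat.add_eq_zero_iff, one_ne_zero, and_false,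
          not_false_eq_true, zero_pow]
        positivity
    · rw [lam_zero]
      simpa using le_mul_of_one_le_left (inv_pos.2 hM0).le hA
  · have hf : 0 < freq k := by linarith [(one_le_freq hk).1, (one_le_freq hk).2]
    obtain ⟨p, hp⟩ := h3.exists_argmax hM (div_pos hf hs)
    obtain ⟨i, hi⟩ := exists_norm_symbol_eq_freq hk
    have hMp := hM p
    have hMr := hM (p + 2 * d)
    refine ⟨List.replicate (p + 2 * d) i, (freq k / s) ^ p / M p,
      ((2 * π * Complex.I * k i) ^ (p + 2 * d))⁻¹, by positivity, fun q => ?_, ?_,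
      fun ψ hψ hc => ?_⟩
    · have := hp q
      rw [div_le_iff₀ (hM q), div_pow, div_le_iff₀ (pow_pos hs q)] at this
      linarith
    · rw [List.length_replicate, norm_inv, norm_pow, hi]
      have e : (freq k ^ (p + 2 * d))⁻¹ * ((freq k / s) ^ p / M p) =
          (freq k ^ (2 * d))⁻¹ * (1 / (s ^ p * M p)) := by
        rw [pow_add, div_pow]; field_simp
      rw [e, mul_comm A, mul_assoc]
      refine mul_le_mul (inv_freq_pow_le_lam hk) ?_ (by positivity) (lam_pos k).le
      rw [← mul_div_assoc, div_le_div_iff₀ (by positivity) hMr, one_mul]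
      refine (hb p).trans ?_
      have h4 : (H / s) ^ p ≤ max 1 (H / s) ^ (p + 2 * d) :=
        (pow_le_pow_left₀ (by positivity) (le_max_right _ _) p).trans
          (pow_le_pow_right₀ (le_max_left _ _) (by omega))
      rw [div_pow, div_le_iff₀ (pow_pos hs p)] at h4
      calc A * H ^ p * M p ≤ A * (max 1 (H / s) ^ (p + 2 * d) * s ^ p) * M p := by gcongr
        _ = _ := by ring
    · rw [fcoeff_wder_replicate hψ hc, inv_mul_cancel_left₀]
      refine pow_ne_zero _ (norm_pos_iff.1 ?_)
      rw [hi]; exact hf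

lemma IsTestD.const_mul {M : ℕ → ℝ} (hM : ∀ p, 0 < M p) {φ : Rd d → ℂ} (h : IsTestD M φ)
    (c : ℂ) : IsTestD M (fun x => c * φ x) := by
  rw [isTestD_iff hM] at h ⊢
  exact ⟨contDiff_const.mul h.1, h.2.1.mul_left, h.2.2.const_mul h.1 c⟩

lemma IsTestD.sub {M : ℕ → ℝ} (hM : ∀ p, 0 < M p) {φ ψ : Rd d → ℂ} (h : IsTestD M φ)
    (h' : IsTestD M ψ) : IsTestD M (fun x => φ x - ψ x) := by
  rw [isTestD_iff hM] at h h' ⊢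
  exact ⟨h.1.sub h'.1, h.2.1.sub h'.2.1, h.2.2.sub h.1 h'.1 h'.2.2⟩

/-- Expansion of a continuous functional along a series converging in the corresponding norm. -/
lemma hasSum_apply_series {ι : Type*} {M : ℕ → ℝ} (hM : ∀ p, 0 < M p) {ℓ C : ℝ} (hℓ : 0 < ℓ)
    (hC : 0 ≤ C) {K : Set (Rd d)} (hK : IsClosed K) {T : (Rd d → ℂ) →ₗ[ℂ] ℂ}
    (hT : ∀ φ : Rd d → ℂ, IsTestD M φ → tsupport φ ⊆ K → ‖T φ‖ ≤ C * Enorm M ℓ K φ)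
    {g : ι → Rd d → ℂ} (hg : ∀ k, IsTestD M (g k)) (hgK : ∀ k, tsupport (g k) ⊆ K)
    (hgb : ∀ k w x, ‖wder w (g k) x‖ ≤ ℓ ^ w.length * M w.length) {c : ι → ℂ}
    (hc : Summable fun k => ‖c k‖) {ψ : Rd d → ℂ} (hψ : IsTestD M ψ)
    (h : ∀ x, HasSum (fun k => c k * g k x) (ψ x)) :
    HasSum (fun k => c k * T (g k)) (T ψ) := by
  classical
  set r : Finset ι → Rd d → ℂ := fun S x => ψ x - ∑ k ∈ S, c k * g k x with hr
  have hrT : ∀ S, IsTestD M (r S) := fun S => by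
    induction S using Finset.induction_on with
    | empty => simpa [hr] using hψ
    | insert a S ha ih =>
      have := ih.sub hM ((hg a).const_mul hM (c a))
      have e : r (insert a S) = fun x => r S x - c a * g a x := by
        ext x; simp only [hr, Finset.sum_insert ha]; ring
      rwa [e]
  have hrs : ∀ S, r S = fun x => ∑' k : {k // k ∉ S}, c k * g k x := fun S => by
    ext x
    have := ((h x).summable).sum_add_tsum_subtype_compl S
    rw [(h x).tsum_eq] at this
    simp only [hr, ← this]; ring
  have hrb : ∀ S, ‖T (r S)‖ ≤ C * ∑' k : {k // k ∉ S}, ‖c k‖ := fun S => by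
    have hcS : Summable fun k : {k // k ∉ S} => ‖c k‖ := hc.subtype _
    have hb : ∀ w x, ‖wder w (r S) x‖ ≤
        (∑' k : {k // k ∉ S}, ‖c k‖) * (ℓ ^ w.length * M w.length) := fun w x => by
      rw [hrs, wder_series (c := fun k : {k // k ∉ S} => c k) hcS w (fun k => (hg k).smooth)
        fun w => ⟨_, fun k x => hgb k w x⟩]
      exact norm_tsum_mul_le hcS fun k => hgb k w x
    refine (hT _ (hrT S) ?_).trans (mul_le_mul_of_nonneg_left
      (Enorm_le hM hℓ (tsum_nonneg fun _ => norm_nonneg _) fun w x _ => hb w x) hC)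
    rw [hrs]
    exact tsupport_series_subset (c := fun k : {k // k ∉ S} => c k) hK fun k => hgK k
  have hlim : Tendsto (fun S => T (r S)) atTop (𝓝 0) := by
    refine squeeze_zero_norm hrb ?_
    simpa using (tendsto_tsum_compl_atTop_zero fun k => ‖c k‖).const_mul C
  have e : ∀ S, ∑ k ∈ S, c k * T (g k) = T ψ - T (r S) := fun S => by
    have : r S = ψ - ∑ k ∈ S, c k • g k := by
      ext x; simp [hr]
    rw [this, map_sub, map_sum]; simp
  rw [HasSum]
  simp_rw [e]
  simpa using (tendsto_const_nhds (x := T ψ)).sub hlim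

lemma norm_fcoeff_le {K : Set (Rd d)} (hK : IsCompact K) {ψ : Rd d → ℂ} {B : ℝ}
    (hs : ∀ x ∉ K, ψ x = 0) (hB : ∀ x, ‖ψ x‖ ≤ B) (k : Fin d → ℤ) :
    ‖fcoeff ψ k‖ ≤ B * volume.real K := by
  rw [fcoeff, ← setIntegral_eq_integral_of_forall_compl_eq_zero (s := K)
    fun x hx => by rw [hs x hx, zero_mul]]
  refine norm_setIntegral_le_of_norm_le_const hK.measure_lt_top fun x _ => ?_
  rw [norm_mul, norm_echar, mul_one]
  exact hB x

lemma beurling_echar {M : ℕ → ℝ} (k : Fin d → ℤ)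
    (hk : ∀ s > (0 : ℝ), ∃ E : ℝ, 0 < E ∧ ∀ q, freq k ^ q ≤ E * (s ^ q * M q)) :
    Beurling M (echar k) := by
  intro s hs
  obtain ⟨E, hE, h⟩ := hk s hs
  exact ⟨E, hE.le, fun w x => (norm_wder_echar_le k w x).trans (h _)⟩

/-- Series expansion of the values of an S-asymptotically bounded ultradistribution on translates
of test functions supported in a fixed small cube. -/
lemma exists_expansion {M : ℕ → ℝ} (h1 : IsM1 M) (h2 : IsM2' M) (h3 : IsM3' M) {ω : Rd d → ℝ}
    (hω : ∀ x, 0 < ω x) {f : (Rd d → ℂ) →ₗ[ℂ] ℂ} (hf : IsUltraD M f)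
    (hb : ∀ φ : Rd d → ℂ, IsTestD M φ →
      ∃ C : ℝ, ∀ h : Rd d, ‖f (fun x => φ (x - h))‖ ≤ C * ω h)
    {η : Rd d → ℂ} (hη : IsTestD M η) (hηs : tsupport η ⊆ cbox (1 / 8) (7 / 8))
    (hη1 : ∀ x ∈ cbox (3 / 8) (5 / 8), η x = 1) :
    ∃ t ≥ (1 : ℝ), ∃ C > (0 : ℝ), ∃ (u : (Fin d → ℤ) → List (Fin d)) (b : Rd d → (Fin d → ℤ) → ℂ),
      (∀ h k, ‖b h k‖ ≤ C * ω h * (lam k * (t ^ (u k).length / M (u k).length))) ∧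
      ∀ ψ : Rd d → ℂ, IsTestD M ψ → tsupport ψ ⊆ cbox (3 / 8) (5 / 8) → ∀ h,
        HasSum (fun k => b h k * fcoeff (wder (u k) ψ) k) (f fun x => ψ (x - h)) := by
  have hM := h1.1
  have hK := isCompact_cbox (d := d) (1 / 8) (7 / 8)
  obtain ⟨ℓ, hℓ, C₀, hC₀, hT⟩ := equicontinuous_translates hM hω hf hb hK
  obtain ⟨t, ht, C₁, hC₁, hfr⟩ := exists_frequency_data (d := d) h1 h2 h3 (half_pos hℓ)
  choose u E z hE hfq hz hi using hfr
  obtain ⟨Cη, hCη, hηb⟩ := hη.beurling hM (ℓ / 2) (half_pos hℓ)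
  have hec : ∀ k : Fin d → ℤ, Beurling M (echar k) := fun k => beurling_echar k fun s hs => by
    obtain ⟨_, _, _, _, hk⟩ := exists_frequency_data (d := d) h1 h2 h3 hs
    obtain ⟨_, E, _, hE, h, _⟩ := hk k
    exact ⟨E, hE, h⟩
  set A : ℝ := (Cη + 1) * M 0
  have hM0 := hM 0
  have hA : 0 < A := by positivity
  have hw : ∀ k w x, ‖wder w (fun y => η y * echar k y) x‖ ≤
      A * E k * (ℓ ^ w.length * M w.length) := fun k w x => by
    have := hE k
    have := norm_wder_mul_le (U := fun p => Cη * ((ℓ / 2) ^ p * M p))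
      (V := fun p => E k * ((ℓ / 2) ^ p * M p))
      (W := fun p => A * E k * ((ℓ / 2) ^ p * M p)) x w hη.smooth (smooth_echar k)
      (fun p => by have := hM p; positivity) (fun v => hηb v x)
      (fun v => (norm_wder_echar_le k v x).trans (hfq k _)) (fun p q => by
        have h := h1.mul_le p q
        have := hM p
        have := hM q
        have := hM (p + q)
        calc Cη * ((ℓ / 2) ^ p * M p) * (E k * ((ℓ / 2) ^ q * M q))
            = Cη * E k * (ℓ / 2) ^ (p + q) * (M p * M q) := by rw [pow_add]; ring
          _ ≤ (Cη + 1) * E k * (ℓ / 2) ^ (p + q) * (M 0 * M (p + q)) := by gcongr; linarith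
          _ = _ := by simp only [A]; ring)
    refine this.trans (le_of_eq ?_)
    have : (2 : ℝ) ^ w.length * (ℓ / 2) ^ w.length = ℓ ^ w.length := by
      rw [← mul_pow]; congr 1; ring
    rw [← this]; ring
  have hgT : ∀ k, IsTestD M (fun y => η y * echar k y) := fun k =>
    (isTestD_iff hM).2 ⟨hη.smooth.mul (smooth_echar k), hη.2.1.mul_right,
      (hη.beurling hM).mul h1 hη.smooth (smooth_echar k) (hec k)⟩
  have hgK : ∀ k, tsupport (fun y => η y * echar k y) ⊆ cbox (1 / 8) (7 / 8) := fun k =>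
    (tsupport_mul_subset_left (f := η)).trans hηs
  refine ⟨t, ht, C₀ * A * C₁, by positivity, u,
    fun h k => z k * f (fun x => η (x - h) * echar k (x - h)), fun h k => ?_,
    fun ψ hψ hψs h => ?_⟩
  · have h4 := hT _ (hgT k) (hgK k) h
    have h5 := Enorm_le hM hℓ (mul_pos hA (hE k)).le fun w x (_ : x ∈ cbox (1 / 8) (7 / 8)) =>
      hw k w x
    have := hω h
    rw [norm_mul]
    calc ‖z k‖ * ‖f (fun x => η (x - h) * echar k (x - h))‖
        ≤ ‖z k‖ * (C₀ * ω h * (A * E k)) := by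
          refine mul_le_mul_of_nonneg_left (h4.trans ?_) (norm_nonneg _)
          gcongr
      _ = C₀ * ω h * A * (‖z k‖ * E k) := by ring
      _ ≤ C₀ * ω h * A * (C₁ * lam k * (t ^ (u k).length / M (u k).length)) :=
          mul_le_mul_of_nonneg_left (hz k) (by positivity)
      _ = _ := by ring
  · obtain ⟨Cψ, hCψ, hψb⟩ := hψ.beurling hM (1 / t) (by positivity)
    have hψ0 : ∀ x ∉ cbox (3 / 8) (5 / 8), ψ x = 0 := fun x hx =>
      image_eq_zero_of_notMem_tsupport fun h => hx (hψs h)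
    set V := volume.real (cbox (d := d) (3 / 8) (5 / 8))
    have hcb : ∀ k, ‖fcoeff ψ k‖ * E k ≤ C₁ * Cψ * V * lam k := fun k => by
      have := hE k
      have hMu := hM (u k).length
      rw [hi k ψ hψ.smooth hψ.2.1, norm_mul]
      have h6 := norm_fcoeff_le (isCompact_cbox (d := d) (3 / 8) (5 / 8))
        (fun x hx => wder_eq_zero_of_notMem (fun h => hx (hψs h)) (u k)) (hψb (u k)) k
      calc ‖z k‖ * ‖fcoeff (wder (u k) ψ) k‖ * E k
          = (‖z k‖ * E k) * ‖fcoeff (wder (u k) ψ) k‖ := by ring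
        _ ≤ _ := mul_le_mul (hz k) h6 (norm_nonneg _) ((mul_nonneg (norm_nonneg _) this.le).trans (hz k))
        _ = C₁ * Cψ * V * lam k * (t ^ (u k).length * (1 / t) ^ (u k).length) := by
          field_simp; ring
        _ = _ := by rw [← mul_pow, mul_one_div_cancel (by positivity), one_pow, mul_one]
    have hs1 : Summable fun k => ‖fcoeff ψ k‖ * E k :=
      Summable.of_nonneg_of_le (fun k => mul_nonneg (norm_nonneg _) (hE k).le) hcb
        (summable_lam.mul_left _)
    have hs2 : Summable (fcoeff ψ) := by
      refine Summable.of_norm_bounded (hs1.mul_right (M 0)) fun k => ?_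
      have := hfq k 0
      simp only [pow_zero, one_mul] at this
      rw [mul_assoc]
      exact le_mul_of_one_le_right (norm_nonneg _) this
    have hAE : ∀ k, ((A * E k : ℝ) : ℂ) ≠ 0 := fun k =>
      Complex.ofReal_ne_zero.2 (mul_pos hA (hE k)).ne'
    have key := hasSum_apply_series hM hℓ (C := C₀ * ω h) (mul_pos hC₀ (hω h)).le hK.isClosed
      (T := f ∘ₗ LinearMap.funLeft ℂ ℂ fun x => x - h) (fun φ hφ hφs => hT φ hφ hφs h)
      (g := fun k x => ((A * E k : ℝ) : ℂ)⁻¹ * (η x * echar k x))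
      (fun k => (hgT k).const_mul hM _)
      (fun k => (tsupport_mul_subset_right (f := fun _ => ((A * E k : ℝ) : ℂ)⁻¹)
        (g := fun x => η x * echar k x)).trans (hgK k))
      (fun k w x => by
        rw [wder_const_mul _ (hgT k).smooth, norm_mul, norm_inv, Complex.norm_real,
          Real.norm_of_nonneg (mul_pos hA (hE k)).le, inv_mul_le_iff₀ (mul_pos hA (hE k))]
        exact hw k w x)
      (c := fun k => fcoeff ψ k * ((A * E k : ℝ) : ℂ))
      (by
        refine (hs1.mul_left A).congr fun k => ?_
        rw [norm_mul, Complex.norm_real, Real.norm_of_nonneg (mul_pos hA (hE k)).le]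
        ring) hψ (fun x => by
        by_cases hx : x ∈ cbox (1 / 8) (7 / 8)
        · have h7 := (hasSum_fcoeff hψ.smooth.continuous (fun x hx => hψ0 x fun h => hx fun i =>
            ⟨by linarith [(h i).1], by linarith [(h i).2]⟩) hs2 hx).mul_left (η x)
          have h8 : η x * ψ x = ψ x := by
            by_cases hx' : x ∈ cbox (3 / 8) (5 / 8)
            · rw [hη1 x hx', one_mul]
            · rw [hψ0 x hx', mul_zero]
          rw [h8] at h7
          refine h7.congr_fun fun k => ?_
          have := hAE k
          field_simp
        · have h9 : η x = 0 := image_eq_zero_of_notMem_tsupport fun h => hx (hηs h)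
          have h10 : ψ x = 0 := hψ0 x fun h => hx fun i =>
            ⟨by linarith [(h i).1], by linarith [(h i).2]⟩
          simp [h9, h10])
    refine key.congr_fun fun k => ?_
    have e : (f ∘ₗ LinearMap.funLeft ℂ ℂ fun x => x - h)
        (fun x => ((A * E k : ℝ) : ℂ)⁻¹ * (η x * echar k x)) =
        ((A * E k : ℝ) : ℂ)⁻¹ * f (fun x => η (x - h) * echar k (x - h)) := by
      exact (f ∘ₗ LinearMap.funLeft ℂ ℂ fun x => x - h).map_smul _ fun x => η x * echar k x
    rw [e, hi k ψ hψ.smooth hψ.2.1]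
    have := hAE k
    field_simp

/-- All ways of distributing the letters of a word over two words. -/
def splits : List (Fin d) → List (List (Fin d) × List (Fin d))
  | [] => [([], [])]
  | i :: u => (splits u).map (fun s => (s.1, i :: s.2)) ++ (splits u).map fun s => (i :: s.1, s.2)

lemma length_splits (u : List (Fin d)) : (splits u).length = 2 ^ u.length := by
  induction u with
  | nil => rfl
  | cons i u ih => simp [splits, ih, pow_succ]; ring

lemma length_add_length_of_mem_splits {u : List (Fin d)} {s : List (Fin d) × List (Fin d)}
    (hs : s ∈ splits u) : s.1.length + s.2.length = u.length := by
  induction u generalizing s with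
  | nil => simp_all [splits]
  | cons i u ih =>
    simp only [splits, List.mem_append, List.mem_map] at hs
    obtain ⟨s, h, rfl⟩ | ⟨s, h, rfl⟩ := hs <;> have := ih h <;> simp <;> omega

lemma smooth_list_sum {κ : Type*} {F : κ → Rd d → ℂ} (hF : ∀ s, Smooth (F s)) (L : List κ) :
    Smooth fun x => (L.map fun s => F s x).sum := by
  induction L with
  | nil => simpa using contDiff_const
  | cons s L ih => simpa using (hF s).add ih

lemma pder_list_sum {κ : Type*} {F : κ → Rd d → ℂ} (hF : ∀ s, Smooth (F s)) (L : List κ)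
    (i : Fin d) : pder i (fun x => (L.map fun s => F s x).sum) =
      fun x => (L.map fun s => pder i (F s) x).sum := by
  induction L with
  | nil => ext x; simp [pder]
  | cons s L ih =>
    simp only [List.map_cons, List.sum_cons]
    rw [pder_add (hF s) (smooth_list_sum hF L), ih]

lemma wder_mul_eq_sum_splits {χ φ : Rd d → ℂ} (hχ : Smooth χ) (hφ : Smooth φ)
    (u : List (Fin d)) : wder u (fun y => χ y * φ y) =
      fun x => ((splits u).map fun s => wder s.1 χ x * wder s.2 φ x).sum := by
  induction u with
  | nil => simp [splits]
  | cons i u ih =>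
    rw [wder_cons, ih, pder_list_sum (F := fun s : List (Fin d) × List (Fin d) => fun x =>
      wder s.1 χ x * wder s.2 φ x) fun s => (hχ.wder s.1).mul (hφ.wder s.2)]
    ext x
    simp only [splits, List.map_append, List.map_map, List.sum_append, Function.comp_def,
      pder_mul (hχ.wder _) (hφ.wder _), wder_cons, List.sum_map_add]

/-- The coefficient of `∂^β φ` in the derivative of `χ φ` along the word `u`. -/
def leibnizCoeff (χ : Rd d → ℂ) (u : List (Fin d)) (β : Fin d → ℕ) (x : Rd d) : ℂ :=
  ((splits u).map fun s => if β = (fun i => s.2.count i) then wder s.1 χ x else 0).sum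

lemma continuous_leibnizCoeff {χ : Rd d → ℂ} (hχ : Smooth χ) (u : List (Fin d))
    (β : Fin d → ℕ) : Continuous (leibnizCoeff χ u β) :=
  (smooth_list_sum (F := fun (s : List (Fin d) × List (Fin d)) x => if β = (fun i => s.2.count i) then wder s.1 χ x else 0)
    (fun s => by split_ifs; exacts [hχ.wder _, contDiff_const]) (splits u)).continuous

lemma leibnizCoeff_eq_zero {χ : Rd d → ℂ} {x : Rd d} (hx : x ∉ tsupport χ) (u : List (Fin d))
    (β : Fin d → ℕ) : leibnizCoeff χ u β x = 0 := by
  simp [leibnizCoeff, wder_eq_zero_of_notMem hx]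

lemma hasSum_list_sum_ite {κ ι : Type*} [DecidableEq ι] (L : List κ) (p : κ → ι) (a : κ → ℂ)
    (m : ι → ℂ) : HasSum (fun β => (L.map fun s => if β = p s then a s else 0).sum * m β)
      (L.map fun s => a s * m (p s)).sum := by
  induction L with
  | nil => simp
  | cons s L ih =>
    simp only [List.map_cons, List.sum_cons, add_mul]
    refine HasSum.add ?_ ih
    convert hasSum_ite_eq (p s) (a s * m (p s)) using 2 with β
    split_ifs with h <;> simp [h]

lemma hasSum_leibniz {χ φ : Rd d → ℂ} (hχ : Smooth χ) (hφ : Smooth φ) (u : List (Fin d))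
    (x : Rd d) : HasSum (fun β => leibnizCoeff χ u β x * mderiv β φ x)
      (wder u (fun y => χ y * φ y) x) := by
  rw [wder_mul_eq_sum_splits hχ hφ]
  simp only [wder_eq_mderiv hφ]
  exact hasSum_list_sum_ite (splits u) (fun s i => s.2.count i) (fun s => wder s.1 χ x)
    fun β => mderiv β φ x

lemma norm_list_sum_map_le {κ : Type*} (L : List κ) {F : κ → ℂ} {B : ℝ}
    (h : ∀ s ∈ L, ‖F s‖ ≤ B) : ‖(L.map F).sum‖ ≤ L.length * B := by
  induction L with
  | nil => simp
  | cons s L ih =>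
    simp only [List.map_cons, List.sum_cons, List.length_cons, Nat.cast_add, Nat.cast_one]
    have h1 := h s (by simp)
    have h2 := ih fun s hs => h s (by simp [hs])
    refine (norm_add_le _ _).trans ?_
    linarith

lemma norm_leibnizCoeff_le {M : ℕ → ℝ} (h1 : IsM1 M) {t C : ℝ} (ht : 0 < t) (hC : 0 ≤ C)
    {χ : Rd d → ℂ} (hb : ∀ v x, ‖wder v χ x‖ ≤ C * ((1 / (2 * t)) ^ v.length * M v.length))
    (u : List (Fin d)) (β : Fin d → ℕ) (x : Rd d) :
    ‖leibnizCoeff χ u β x‖ * (t ^ u.length / M u.length) ≤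
      C * M 0 * ((2 * t) ^ mOrd β / M (mOrd β)) := by
  have hM0 := h1.1 0
  have hMu := h1.1 u.length
  have hMβ := h1.1 (mOrd β)
  set B : ℝ := C * M 0 * ((2 * t) ^ mOrd β / M (mOrd β)) * (M u.length / (2 * t) ^ u.length)
  have key : ‖leibnizCoeff χ u β x‖ ≤ (splits u).length * B := by
    refine norm_list_sum_map_le _ fun s hs => ?_
    split_ifs with h
    · have hl := length_add_length_of_mem_splits hs
      have hq : mOrd β = s.2.length := by rw [h, mOrd_count]
      refine (hb s.1 x).trans ?_
      have h4 := h1.mul_le s.1.length s.2.length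
      simp only [B, hq, ← hl, mul_assoc] at *
      refine mul_le_mul_of_nonneg_left ?_ hC
      have := h1.1 s.1.length
      have e : M 0 * ((2 * t) ^ s.2.length / M s.2.length * (M (s.1.length + s.2.length) /
          (2 * t) ^ (s.1.length + s.2.length))) =
          (1 / (2 * t)) ^ s.1.length * (M 0 * M (s.1.length + s.2.length) / M s.2.length) := by
        rw [pow_add, one_div_pow]; field_simp
      rw [e]
      refine mul_le_mul_of_nonneg_left ?_ (by positivity)
      rwa [le_div_iff₀ hMβ]
    · simp only [norm_zero]; positivity
  rw [length_splits] at key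
  push_cast at key
  calc ‖leibnizCoeff χ u β x‖ * (t ^ u.length / M u.length)
      ≤ 2 ^ u.length * B * (t ^ u.length / M u.length) := by gcongr
    _ = _ := by simp only [B, mul_pow]; field_simp

lemma integrable_mul_mderiv {G φ : Rd d → ℂ} (hG : Continuous G) (hφ : Smooth φ)
    (hc : HasCompactSupport φ) (β : Fin d → ℕ) : Integrable fun x => G x * mderiv β φ x := by
  rw [mderiv_eq_wder]
  exact (hG.mul (hφ.wder _).continuous).integrable_of_hasCompactSupport
    (HasCompactSupport.wder hc _).mul_left

lemma integral_norm_mul_mderiv_le {M : ℕ → ℝ} {G φ : Rd d → ℂ}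
    (hc : HasCompactSupport φ) {β : Fin d → ℕ} {B C ε : ℝ} (hB : 0 ≤ B)
    (hG : ∀ x ∈ tsupport φ, ‖G x‖ ≤ B)
    (hb : ∀ w x, ‖wder w φ x‖ ≤ C * (ε ^ w.length * M w.length)) :
    ∫ x, ‖G x * mderiv β φ x‖ ≤
      B * (C * (ε ^ mOrd β * M (mOrd β))) * volume.real (tsupport φ) := by
  rw [mderiv_eq_wder, ← setIntegral_eq_integral_of_forall_compl_eq_zero (s := tsupport φ)
    fun x hx => by rw [wder_eq_zero_of_notMem hx, mul_zero, norm_zero]]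
  refine (Real.le_norm_self _).trans ?_
  refine norm_setIntegral_le_of_norm_le_const (IsCompact.measure_lt_top (μ := volume) hc) fun x hx => ?_
  rw [norm_norm, norm_mul, ← length_mword]
  exact mul_le_mul (hG x hx) (hb _ _) (norm_nonneg _) hB

lemma summable_half_pow_mOrd : Summable fun β : Fin d → ℕ => (1 / 2 : ℝ) ^ mOrd β := by
  simpa only [mOrd, Finset.prod_pow_eq_pow_sum] using
    summable_pi_prod (d := d) (f := fun q : ℕ => (1 / 2 : ℝ) ^ q) (fun _ => by positivity)
      summable_geometric_two

/-- Representation of the localisations of an S-asymptotically bounded ultradistribution as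
series of derivatives of continuous functions. -/
lemma exists_local_structure {M : ℕ → ℝ} (h1 : IsM1 M) (h2 : IsM2' M) (h3 : IsM3' M)
    {ω : Rd d → ℝ} (hω : ∀ x, 0 < ω x) {f : (Rd d → ℂ) →ₗ[ℂ] ℂ} (hf : IsUltraD M f)
    (hb : ∀ φ : Rd d → ℂ, IsTestD M φ →
      ∃ C : ℝ, ∀ h : Rd d, ‖f (fun x => φ (x - h))‖ ≤ C * ω h)
    {χ η : Rd d → ℂ} (hχ : IsTestD M χ) (hχs : tsupport χ ⊆ cbox (3 / 8) (5 / 8))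
    (hη : IsTestD M η) (hηs : tsupport η ⊆ cbox (1 / 8) (7 / 8))
    (hη1 : ∀ x ∈ cbox (3 / 8) (5 / 8), η x = 1) :
    ∃ τ > (0 : ℝ), ∃ C > (0 : ℝ), ∃ H : Rd d → (Fin d → ℕ) → Rd d → ℂ,
      (∀ h β, Continuous (H h β)) ∧
      (∀ h β x, ‖H h β x‖ ≤ C * (τ ^ mOrd β / M (mOrd β)) * ω h) ∧
      (∀ h β x, x - h ∉ cbox (3 / 8) (5 / 8) → H h β x = 0) ∧
      ∀ φ : Rd d → ℂ, IsTestD M φ → ∀ h,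
        HasSum (fun β => ∫ x, H h β x * mderiv β φ x) (f fun x => χ (x - h) * φ x) := by
  have hM := h1.1
  obtain ⟨t, ht, C₀, hC₀, u, b, hbb, hsum⟩ := exists_expansion h1 h2 h3 hω hf hb hη hηs hη1
  have ht0 : 0 < t := by linarith
  obtain ⟨C₁, hC₁, hχb⟩ := hχ.beurling hM (1 / (2 * t)) (by positivity)
  set G : Rd d → (Fin d → ℕ) → (Fin d → ℤ) → Rd d → ℂ := fun h β k x =>
    b h k * leibnizCoeff χ (u k) β (x - h) * echar (-k) (x - h) with hGdef
  have hGc : ∀ h β k, Continuous (G h β k) := fun h β k => by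
    have e : Continuous fun x : Rd d => x - h := continuous_id.sub continuous_const
    exact (continuous_const.mul ((continuous_leibnizCoeff hχ.smooth _ _).comp e)).mul
      ((smooth_echar (-k)).continuous.comp e)
  set D : ℝ := C₀ * ((C₁ + 1) * M 0)
  have hM0 := hM 0
  have hD : 0 < D := by positivity
  have hGb : ∀ h β k x, ‖G h β k x‖ ≤
      D * ((2 * t) ^ mOrd β / M (mOrd β)) * ω h * lam k := fun h β k x => by
    have h4 := norm_leibnizCoeff_le h1 ht0 (by positivity : 0 ≤ C₁ + 1) (χ := χ)
      (fun v x => (hχb v x).trans (mul_le_mul_of_nonneg_right (by linarith)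
        (by have := hM v.length; positivity))) (u k) β (x - h)
    have := hω h
    have := lam_pos k
    simp only [hGdef, norm_mul, norm_echar, mul_one]
    calc ‖b h k‖ * ‖leibnizCoeff χ (u k) β (x - h)‖
        ≤ C₀ * ω h * (lam k * (t ^ (u k).length / M (u k).length)) *
            ‖leibnizCoeff χ (u k) β (x - h)‖ :=
          mul_le_mul_of_nonneg_right (hbb h k) (norm_nonneg _)
      _ = C₀ * ω h * lam k *
            (‖leibnizCoeff χ (u k) β (x - h)‖ * (t ^ (u k).length / M (u k).length)) := by ring
      _ ≤ _ := mul_le_mul_of_nonneg_left h4 (by positivity)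
      _ = _ := by simp only [D]; ring
  have hGs : ∀ h β x, Summable fun k => G h β k x := fun h β x =>
    Summable.of_norm_bounded (summable_lam.mul_left _) fun k => hGb h β k x
  refine ⟨2 * t, by positivity, D * (∑' k : Fin d → ℤ, lam k + 1), ?_,
    fun h β x => ∑' k, G h β k x, fun h β => ?_, fun h β x => ?_, fun h β x hx => ?_,
    fun φ hφ h => ?_⟩
  · have : 0 ≤ ∑' k : Fin d → ℤ, lam k := tsum_nonneg fun k => (lam_pos k).le
    positivity
  · exact continuous_tsum (hGc h β) (summable_lam.mul_left _) fun k x => hGb h β k x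
  · refine (tsum_of_norm_bounded (summable_lam.mul_left _).hasSum fun k => hGb h β k x).trans ?_
    rw [tsum_mul_left]
    have := hω h
    have := hM (mOrd β)
    have : 0 ≤ D * ((2 * t) ^ mOrd β / M (mOrd β)) * ω h := by positivity
    nlinarith
  · have : ∀ k, G h β k x = 0 := fun k => by
      simp [hGdef, leibnizCoeff_eq_zero fun h' => hx (hχs h')]
    simp [this]
  · obtain ⟨C₂, hC₂, hφb⟩ := hφ.beurling hM (1 / (2 * (2 * t))) (by positivity)
    have hωh := hω h
    have hint : ∀ β k, Integrable fun x => G h β k x * mderiv β φ x := fun β k =>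
      integrable_mul_mderiv (hGc h β k) hφ.smooth hφ.2.1 β
    have hbd : ∀ β k, ∫ x, ‖G h β k x * mderiv β φ x‖ ≤
        D * ω h * C₂ * volume.real (tsupport φ) * (lam k * (1 / 2) ^ mOrd β) := fun β k => by
      have := hM (mOrd β)
      have := lam_pos k
      refine (integral_norm_mul_mderiv_le hφ.2.1 (by positivity) (fun x _ => hGb h β k x)
        hφb).trans (le_of_eq ?_)
      rw [one_div_pow, one_div_pow, mul_pow 2 (2 * t)]
      field_simp
    have hsm : Summable fun p : (Fin d → ℤ) × (Fin d → ℕ) =>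
        ∫ x, ‖G h p.2 p.1 x * mderiv p.2 φ x‖ :=
      Summable.of_nonneg_of_le (fun p => integral_nonneg fun x => norm_nonneg _)
        (fun p => hbd p.2 p.1) ((summable_lam.mul_of_nonneg summable_half_pow_mOrd
          (fun k => (lam_pos k).le) fun β => by positivity).mul_left _)
    have hk : ∀ k, HasSum (fun β => ∫ x, G h β k x * mderiv β φ x)
        (b h k * fcoeff (wder (u k) fun y => χ y * φ (y + h)) k) := fun k => by
      have h4 : Summable fun β => ∫ x, ‖G h β k x * mderiv β φ x‖ := hsm.prod_factor k
      have h5 := hasSum_integral_of_summable_integral_norm (fun β => hint β k) h4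
      suffices e : b h k * fcoeff (wder (u k) fun y => χ y * φ (y + h)) k =
          ∫ x, ∑' β, G h β k x * mderiv β φ x by rwa [e]
      rw [fcoeff, ← integral_const_mul, ← integral_sub_right_eq_self _ h]
      refine integral_congr_ae (.of_forall fun x => ?_)
      have h6 := (hasSum_leibniz hχ.smooth (φ := fun y => φ (y + h))
        (hφ.smooth.comp (contDiff_id.add contDiff_const)) (u k) (x - h)).mul_left
          (b h k * echar (-k) (x - h))
      simp only [mderiv_translate, sub_add_cancel] at h6
      dsimp only
      rw [mul_comm (wder _ _ _), ← mul_assoc, ← h6.tsum_eq]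
      exact tsum_congr fun β => by simp only [hGdef]; ring
    have hβ : ∀ β, HasSum (fun k => ∫ x, G h β k x * mderiv β φ x)
        (∫ x, (∑' k, G h β k x) * mderiv β φ x) := fun β => by
      have h4 : Summable fun k => ∫ x, ‖G h β k x * mderiv β φ x‖ :=
        hsm.prod_symm.prod_factor β
      have h5 := hasSum_integral_of_summable_integral_norm (fun k => hint β k) h4
      simpa only [tsum_mul_right] using h5
    have hall : Summable fun p : (Fin d → ℤ) × (Fin d → ℕ) =>
        ∫ x, G h p.2 p.1 x * mderiv p.2 φ x :=
      Summable.of_norm_bounded hsm fun p => norm_integral_le_integral_norm _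
    have h7 := hall.hasSum.prod_fiberwise hk
    have h8 := ((Equiv.prodComm _ _).hasSum_iff.2 hall.hasSum).prod_fiberwise hβ
    have hψ : IsTestD M fun y => χ y * φ (y + h) := by
      have hφ' := hφ.translate hM (-h)
      simp only [sub_neg_eq_add] at hφ'
      exact (isTestD_iff hM).2 ⟨hχ.smooth.mul hφ'.smooth, hχ.2.1.mul_right,
        (hχ.beurling hM).mul h1 hχ.smooth hφ'.smooth (hφ'.beurling hM)⟩
    have h9 := hsum _ hψ ((tsupport_mul_subset_left (f := χ)).trans hχs) h
    simp only [sub_add_cancel] at h9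
    rwa [h7.unique h9] at h8

lemma OmegaCond.exists_le_of_sub_mem {ω : Rd d → ℝ} (hω : OmegaCond ω) {K : Set (Rd d)}
    (hK : IsCompact K) : ∃ C > (0 : ℝ), ∀ x h, x - h ∈ K → ω h ≤ C * ω x := by
  obtain ⟨R, hR, hb⟩ := hK.isBounded.exists_pos_norm_le
  obtain ⟨C, hC, h⟩ := hω.2.2 R hR
  refine ⟨C, hC, fun x y hxy => ?_⟩
  have := h x (y - x) (by rw [norm_sub_rev]; exact hb _ hxy)
  rwa [add_sub_cancel] at this

lemma exists_lattice_window (x : Rd d) : ∃ P : Finset (Fin d → ℤ), P.card ≤ 3 ^ d ∧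
    ∀ n, x - latt n ∈ cbox (3 / 8) (5 / 8) → n ∈ P := by
  classical
  refine ⟨Fintype.piFinset fun i => Finset.Icc ⌈8 * x i - 5⌉ ⌊8 * x i - 3⌋, ?_, fun n hn => ?_⟩
  · rw [Fintype.card_piFinset]
    refine (Finset.prod_le_pow_card _ _ 3 fun i _ => ?_).trans (by simp)
    rw [Int.card_Icc]
    have h1 := Int.le_ceil (8 * x i - 5)
    have h2 := Int.floor_le (8 * x i - 3)
    have : (⌊8 * x i - 3⌋ : ℝ) ≤ (⌈8 * x i - 5⌉ + 2 : ℤ) := by push_cast; linarith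
    have := Int.cast_le.1 this
    omega
  · rw [Fintype.mem_piFinset]
    intro i
    have := hn i
    simp only [PiLp.sub_apply, latt_apply] at this
    rw [Finset.mem_Icc, Int.ceil_le, Int.le_floor]
    constructor <;> linarith [this.1, this.2]

lemma mem_window_of_mem_cbox {N : ℕ} {x : Rd d} (hx : 8 * ‖x‖ + 5 < N) {n : Fin d → ℤ}
    (hn : x - latt n ∈ cbox (3 / 8) (5 / 8)) :
    n ∈ Fintype.piFinset fun _ : Fin d => Finset.Ico (-N : ℤ) N := by
  rw [Fintype.mem_piFinset]
  intro i
  have h1 := hn i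
  have h2 := abs_le.1 (PiLp.norm_apply_le x i)
  simp only [PiLp.sub_apply, latt_apply] at h1
  rw [Finset.mem_Ico]
  have h3 : ((-N : ℤ) : ℝ) ≤ n i := by push_cast; linarith [h1.1, h1.2, h2.1, h2.2]
  have h4 : (n i : ℝ) < (N : ℤ) := by push_cast; linarith [h1.1, h1.2, h2.1, h2.2]
  exact ⟨Int.cast_le.1 h3, Int.cast_lt.1 h4⟩

/-- The first structure theorem for S-asymptotically bounded ultradistributions. -/
lemma exists_structure {M : ℕ → ℝ} (h1 : IsM1 M) (h2 : IsM2' M) (h3 : IsM3' M)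
    {ω : Rd d → ℝ} (hω : OmegaCond ω) {f : (Rd d → ℂ) →ₗ[ℂ] ℂ} (hf : IsUltraD M f)
    (hb : ∀ φ : Rd d → ℂ, IsTestD M φ →
      ∃ C : ℝ, ∀ h : Rd d, ‖f (fun x => φ (x - h))‖ ≤ C * ω h) :
    ∃ F : (Fin d → ℕ) → Rd d → ℂ, (∀ α, Continuous (F α)) ∧
      ∃ ℓ > (0 : ℝ), ∃ C > (0 : ℝ),
        (∀ (α : Fin d → ℕ) (x : Rd d), ‖F α x‖ ≤ C * (ℓ ^ mOrd α / M (mOrd α)) * ω x) ∧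
        ∀ φ : Rd d → ℂ, IsTestD M φ →
          HasSum (fun α => (-1 : ℂ) ^ mOrd α * ∫ x, F α x * mderiv α φ x) (f φ) := by
  classical
  obtain ⟨χ, η, hχ, hη, hχs, hηs, hη1, hpart⟩ := exists_windows (d := d) h1 h3
  obtain ⟨τ, hτ, C, hC, H, hHc, hHb, hH0, hHsum⟩ :=
    exists_local_structure h1 h2 h3 hω.1 hf hb hχ hχs hη hηs hη1
  obtain ⟨C', hC', hωC⟩ := hω.exists_le_of_sub_mem (isCompact_cbox (d := d) (3 / 8) (5 / 8))
  set S : ℕ → Finset (Fin d → ℤ) := fun N => Fintype.piFinset fun _ => Finset.Ico (-N : ℤ) N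
  have hsum : ∀ β (N : ℕ) x, 8 * ‖x‖ + 5 < N →
      ∑' n, H (latt n) β x = ∑ n ∈ S N, H (latt n) β x := fun β N x hx =>
    tsum_eq_sum fun n hn => hH0 _ _ _ fun h => hn (mem_window_of_mem_cbox hx h)
  have hcont : ∀ β, Continuous fun x => ∑' n, H (latt n) β x := fun β => by
    rw [continuous_iff_continuousAt]
    intro x
    obtain ⟨N, hN⟩ := exists_nat_gt (8 * ‖x‖ + 5)
    have ho : IsOpen {y : Rd d | 8 * ‖y‖ + 5 < N} :=
      isOpen_lt (by fun_prop) continuous_const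
    refine ((continuous_finsetSum (S N) fun n _ => hHc (latt n) β).continuousAt).congr ?_
    filter_upwards [ho.mem_nhds hN] with y hy using (hsum β N y hy).symm
  refine ⟨fun β x => (-1) ^ mOrd β * ∑' n, H (latt n) β x,
    fun β => continuous_const.mul (hcont β), τ, hτ, 3 ^ d * (C * C'), by positivity,
    fun β x => ?_, fun φ hφ => ?_⟩
  · obtain ⟨P, hP, hPm⟩ := exists_lattice_window x
    have hMβ := h1.1 (mOrd β)
    have hωx := hω.1 x
    have hB : 0 ≤ C * C' * (τ ^ mOrd β / M (mOrd β)) * ω x := by positivity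
    rw [norm_mul, norm_pow, norm_neg, norm_one, one_pow, one_mul,
      tsum_eq_sum (s := P) fun n hn => hH0 _ _ _ fun h => hn (hPm n h)]
    refine (norm_sum_le_of_le P (f := fun n => H (latt n) β x)
      (n := fun _ => C * C' * (τ ^ mOrd β / M (mOrd β)) * ω x) fun n _ => ?_).trans ?_
    · by_cases h : x - latt n ∈ cbox (3 / 8) (5 / 8)
      · refine (hHb _ _ _).trans ?_
        calc C * (τ ^ mOrd β / M (mOrd β)) * ω (latt n)
            ≤ C * (τ ^ mOrd β / M (mOrd β)) * (C' * ω x) :=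
              mul_le_mul_of_nonneg_left (hωC x _ h) (by positivity)
          _ = _ := by ring
      · rw [hH0 _ _ _ h, norm_zero]; exact hB
    · rw [Finset.sum_const, nsmul_eq_mul]
      refine (mul_le_mul_of_nonneg_right (Nat.cast_le.2 hP) hB).trans (le_of_eq ?_)
      push_cast; ring
  · obtain ⟨R, -, hR⟩ := (IsCompact.isBounded hφ.2.1).exists_pos_norm_le
    obtain ⟨N, hN⟩ := exists_nat_gt (8 * R + 5)
    have hxN : ∀ x ∈ tsupport φ, 8 * ‖x‖ + 5 < N := fun x hx => by linarith [hR x hx]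
    have hφe : φ = ∑ n ∈ S N, fun x => χ (x - latt n) * φ x := by
      ext x
      rw [Finset.sum_apply, ← Finset.sum_mul]
      by_cases hx : x ∈ tsupport φ
      · have := hpart N x fun i => by
          have h2 := abs_le.1 (PiLp.norm_apply_le x i)
          have := hxN x hx
          have : |8 * x i - 3| ≤ 8 * ‖x‖ + 3 := abs_le.2 ⟨by linarith [h2.1], by linarith [h2.2]⟩
          linarith
        rw [this, one_mul]
      · rw [image_eq_zero_of_notMem_tsupport hx, mul_zero]
    have key := hasSum_sum (s := S N) fun n _ => hHsum φ hφ (latt n)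
    rw [← map_sum, ← hφe] at key
    convert key using 2 with β
    rw [← integral_finsetSum _ fun n _ =>
      integrable_mul_mderiv (hHc _ _) hφ.smooth hφ.2.1 β, ← integral_const_mul]
    refine integral_congr_ae (.of_forall fun x => ?_)
    dsimp only
    rw [← mul_assoc, ← mul_assoc, ← pow_add, Even.neg_one_pow ⟨_, rfl⟩, one_mul,
      ← Finset.sum_mul]
    by_cases hx : x ∈ tsupport φ
    · rw [hsum β N x (hxN x hx)]
    · rw [mderiv_eq_wder, wder_eq_zero_of_notMem hx, mul_zero, mul_zero]

lemma OmegaCond.exists_le_on {ω : Rd d → ℝ} (hω : OmegaCond ω) {K : Set (Rd d)}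
    (hK : IsCompact K) : ∃ W > (0 : ℝ), ∀ x ∈ K, ω x ≤ W := by
  obtain ⟨C, hC, h⟩ := hω.exists_le_of_sub_mem hK.neg
  exact ⟨C * ω 0, mul_pos hC (hω.1 0), fun x hx => h 0 x (by simpa using hx)⟩

lemma integral_norm_mderiv_mul_le {M : ℕ → ℝ} {ω : Rd d → ℝ} (hω : OmegaCond ω) {φ : Rd d → ℂ}
    (hc : HasCompactSupport φ) {W C ε : ℝ} (hW : 0 ≤ W) (hωW : ∀ x ∈ tsupport φ, ω x ≤ W)
    (hb : ∀ w x, ‖wder w φ x‖ ≤ C * (ε ^ w.length * M w.length)) (β : Fin d → ℕ) :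
    ∫ x, ‖mderiv β φ x‖ * ω x ≤
      W * (C * (ε ^ mOrd β * M (mOrd β))) * volume.real (tsupport φ) := by
  have hn : ∀ x, ‖(ω x : ℂ)‖ = ω x := fun x => by
    rw [Complex.norm_real, Real.norm_of_nonneg (hω.1 x).le]
  refine le_trans (le_of_eq ?_) (integral_norm_mul_mderiv_le (G := fun x => (ω x : ℂ)) hc hW
    (fun x hx => (hn x).trans_le (hωW x hx)) hb)
  simp_rw [norm_mul, hn, mul_comm]

lemma IsTestD.integrable_norm_mderiv_mul {M : ℕ → ℝ} {ω : Rd d → ℝ} (hω : OmegaCond ω)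
    {φ : Rd d → ℂ} (hφ : IsTestD M φ) (β : Fin d → ℕ) :
    Integrable fun x => ‖mderiv β φ x‖ * ω x := by
  obtain ⟨W, -, hωW⟩ := hω.exists_le_on hφ.2.1
  rw [mderiv_eq_wder]
  have hc := (hφ.smooth.wder (mword β)).continuous
  refine ((hc.integrable_of_hasCompactSupport
    (HasCompactSupport.wder hφ.2.1 _)).norm.mul_const W).mono'
    (hc.norm.aestronglyMeasurable.mul hω.2.1.aestronglyMeasurable) (.of_forall fun x => ?_)
  rw [norm_mul, norm_norm, Real.norm_of_nonneg (hω.1 x).le]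
  by_cases hx : x ∈ tsupport φ
  · exact mul_le_mul_of_nonneg_left (hωW x hx) (norm_nonneg _)
  · rw [wder_eq_zero_of_notMem hx]; simp

lemma IsTestD.bddAbove_DL1Set {M : ℕ → ℝ} (hM : ∀ p, 0 < M p) {ω : Rd d → ℝ}
    (hω : OmegaCond ω) {φ : Rd d → ℂ} (hφ : IsTestD M φ) {ℓ : ℝ} (hℓ : 0 < ℓ) :
    BddAbove (DL1Set M ω ℓ φ) := by
  obtain ⟨W, hW, hωW⟩ := hω.exists_le_on hφ.2.1
  obtain ⟨C, hC, hb⟩ := hφ.beurling hM ℓ hℓ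
  refine ⟨W * C * volume.real (tsupport φ), ?_⟩
  rintro r ⟨β, rfl⟩
  rw [div_le_iff₀ (mul_pos (pow_pos hℓ _) (hM _))]
  refine (integral_norm_mderiv_mul_le hω hφ.2.1 hW.le hωW hb β).trans (le_of_eq ?_)
  ring

lemma DL1norm_nonneg {M : ℕ → ℝ} (hM : ∀ p, 0 < M p) {ω : Rd d → ℝ} (hω : OmegaCond ω)
    {ℓ : ℝ} (hℓ : 0 < ℓ) (φ : Rd d → ℂ) : 0 ≤ DL1norm M ω ℓ φ := by
  refine Real.sSup_nonneg ?_
  rintro r ⟨β, rfl⟩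
  exact div_nonneg (integral_nonneg fun x => mul_nonneg (norm_nonneg _) (hω.1 x).le)
    (mul_pos (pow_pos hℓ _) (hM _)).le

/-- Summability of the pairings of a test function with a family of functions of controlled
growth. -/
lemma summable_integral_norm_mul_mderiv {M : ℕ → ℝ} (hM : ∀ p, 0 < M p) {ω : Rd d → ℝ}
    (hω : OmegaCond ω) {F : (Fin d → ℕ) → Rd d → ℂ} {ℓ C : ℝ} (hℓ : 0 < ℓ) (hC : 0 < C)
    (hF : ∀ α x, ‖F α x‖ ≤ C * (ℓ ^ mOrd α / M (mOrd α)) * ω x) {φ : Rd d → ℂ}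
    (hφ : IsTestD M φ) : Summable fun α => ∫ x, ‖F α x * mderiv α φ x‖ := by
  obtain ⟨W, hW, hωW⟩ := hω.exists_le_on hφ.2.1
  obtain ⟨C', hC', hb⟩ := hφ.beurling hM (1 / (2 * ℓ)) (by positivity)
  refine Summable.of_nonneg_of_le (fun α => integral_nonneg fun x => norm_nonneg _) (fun α => ?_)
    (summable_half_pow_mOrd.mul_left (C * W * C' * volume.real (tsupport φ)))
  have := hM (mOrd α)
  refine (integral_norm_mul_mderiv_le (G := F α) (B := C * (ℓ ^ mOrd α / M (mOrd α)) * W) hφ.2.1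
    (by positivity) (fun x hx => (hF α x).trans
      (mul_le_mul_of_nonneg_left (hωW x hx) (by positivity))) hb).trans (le_of_eq ?_)
  rw [one_div_pow, one_div_pow, mul_pow]
  field_simp

/-- A series of derivatives of functions of controlled growth is continuous on
`D^{(M_p)}_{L¹_ω}`. -/
lemma norm_le_DL1norm_of_structure {M : ℕ → ℝ} (hM : ∀ p, 0 < M p) {ω : Rd d → ℝ}
    (hω : OmegaCond ω) {F : (Fin d → ℕ) → Rd d → ℂ} (hFc : ∀ α, Continuous (F α)) {ℓ C : ℝ}
    (hℓ : 0 < ℓ) (hC : 0 < C) (hF : ∀ α x, ‖F α x‖ ≤ C * (ℓ ^ mOrd α / M (mOrd α)) * ω x)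
    {φ : Rd d → ℂ} (hφ : IsTestD M φ) :
    ‖∑' α : Fin d → ℕ, (-1 : ℂ) ^ mOrd α * ∫ x, F α x * mderiv α φ x‖ ≤
      C * (∑' α : Fin d → ℕ, (1 / 2 : ℝ) ^ mOrd α + 1) * DL1norm M ω (1 / (2 * ℓ)) φ := by
  have hℓ' : 0 < 1 / (2 * ℓ) := by positivity
  have hN := DL1norm_nonneg hM hω hℓ' φ
  have hterm : ∀ α, ‖(-1 : ℂ) ^ mOrd α * ∫ x, F α x * mderiv α φ x‖ ≤
      C * DL1norm M ω (1 / (2 * ℓ)) φ * (1 / 2) ^ mOrd α := fun α => by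
    have hMα := hM (mOrd α)
    have h1 : (∫ x, ‖mderiv α φ x‖ * ω x) / ((1 / (2 * ℓ)) ^ mOrd α * M (mOrd α)) ≤
        DL1norm M ω (1 / (2 * ℓ)) φ :=
      le_csSup (hφ.bddAbove_DL1Set hM hω hℓ') ⟨α, rfl⟩
    rw [div_le_iff₀ (by positivity)] at h1
    rw [norm_mul, norm_pow, norm_neg, norm_one, one_pow, one_mul]
    calc ‖∫ x, F α x * mderiv α φ x‖ ≤ ∫ x, ‖F α x * mderiv α φ x‖ :=
          norm_integral_le_integral_norm _
      _ ≤ ∫ x, C * (ℓ ^ mOrd α / M (mOrd α)) * (‖mderiv α φ x‖ * ω x) := by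
          refine integral_mono (integrable_mul_mderiv (hFc α) hφ.smooth hφ.2.1 α).norm
            ((hφ.integrable_norm_mderiv_mul hω α).const_mul _) fun x => ?_
          dsimp only
          rw [norm_mul, mul_comm ‖mderiv α φ x‖, ← mul_assoc]
          exact mul_le_mul_of_nonneg_right (hF α x) (norm_nonneg _)
      _ = C * (ℓ ^ mOrd α / M (mOrd α)) * ∫ x, ‖mderiv α φ x‖ * ω x := integral_const_mul _ _
      _ ≤ C * (ℓ ^ mOrd α / M (mOrd α)) * (DL1norm M ω (1 / (2 * ℓ)) φ *
            ((1 / (2 * ℓ)) ^ mOrd α * M (mOrd α))) :=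
          mul_le_mul_of_nonneg_left h1 (by positivity)
      _ = _ := by rw [one_div_pow, one_div_pow, mul_pow]; field_simp
  refine (tsum_of_norm_bounded (summable_half_pow_mOrd.mul_left _).hasSum hterm).trans ?_
  rw [tsum_mul_left]
  have := mul_nonneg hC.le hN
  nlinarith

/-- The weighted norms of the translates of a test function are controlled by the weight. -/
lemma IsTestD.exists_DL1norm_translate_le {M : ℕ → ℝ} (hM : ∀ p, 0 < M p) {ω : Rd d → ℝ}
    (hω : OmegaCond ω) {φ : Rd d → ℂ} (hφ : IsTestD M φ) {ℓ : ℝ} (hℓ : 0 < ℓ) :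
    ∃ B, ∀ h, DL1norm M ω ℓ (fun x => φ (x - h)) ≤ B * ω h := by
  obtain ⟨W, hW, hωW⟩ := hω.exists_le_of_sub_mem (IsCompact.neg hφ.2.1)
  obtain ⟨C, hC, hb⟩ := hφ.beurling hM ℓ hℓ
  refine ⟨W * C * volume.real (tsupport φ), fun h => ?_⟩
  have hωh := hω.1 h
  refine Real.sSup_le ?_ (by positivity)
  rintro r ⟨β, rfl⟩
  rw [div_le_iff₀ (mul_pos (pow_pos hℓ _) (hM _))]
  refine (integral_norm_mderiv_mul_le (M := M) hω (C := C) (ε := ℓ) (W := W * ω h)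
    (hφ.translate hM h).2.1 (by positivity)
    (fun x hx => hωW h x ?_) (fun w x => ?_) β).trans (le_of_eq ?_)
  · rw [tsupport_translate] at hx
    simpa using hx
  · simp only [sub_eq_add_neg, wder_translate]
    exact hb _ _
  · have : volume.real (tsupport fun x => φ (x - h)) = volume.real (tsupport φ) := by
      rw [tsupport_translate, Measure.real, Measure.real]
      simp only [sub_eq_add_neg]
      rw [measure_preimage_add_right]
    rw [this]; ring

end

/-- characterization of `B'^{(M_p)}_ω`: membership in the dual of
`D^{(M_p)}_{L¹_ω}`, the first structure theorem, and S-asymptotic boundedness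
`f(x+h) = O(ω(h))` are all equivalent. -/
theorem stmt7 {d : ℕ} (M : ℕ → ℝ) (hM1 : IsM1 M) (hM2' : IsM2' M) (hM3' : IsM3' M)
    (ω : Rd d → ℝ) (hω : OmegaCond ω)
    (f : (Rd d → ℂ) →ₗ[ℂ] ℂ) (hf : IsUltraD M f) :
    ((∃ ℓ > (0 : ℝ), ∃ C > (0 : ℝ), ∀ φ : Rd d → ℂ, IsTestD M φ →
        ‖f φ‖ ≤ C * DL1norm M ω ℓ φ) ↔
      (∃ F : (Fin d → ℕ) → Rd d → ℂ, (∀ α, Continuous (F α)) ∧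
        ∃ ℓ > (0 : ℝ), ∃ C > (0 : ℝ),
          (∀ (α : Fin d → ℕ) (x : Rd d), ‖F α x‖ ≤ C * (ℓ ^ mOrd α / M (mOrd α)) * ω x) ∧
          ∀ φ : Rd d → ℂ, IsTestD M φ →
            (∀ α : Fin d → ℕ, Integrable fun x => F α x * mderiv α φ x) ∧
            Summable (fun α : Fin d → ℕ => ‖∫ x, F α x * mderiv α φ x‖) ∧
            f φ = ∑' α : Fin d → ℕ, (-1 : ℂ) ^ mOrd α * ∫ x, F α x * mderiv α φ x)) ∧
    ((∃ F : (Fin d → ℕ) → Rd d → ℂ, (∀ α, Continuous (F α)) ∧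
        ∃ ℓ > (0 : ℝ), ∃ C > (0 : ℝ),
          (∀ (α : Fin d → ℕ) (x : Rd d), ‖F α x‖ ≤ C * (ℓ ^ mOrd α / M (mOrd α)) * ω x) ∧
          ∀ φ : Rd d → ℂ, IsTestD M φ →
            (∀ α : Fin d → ℕ, Integrable fun x => F α x * mderiv α φ x) ∧
            Summable (fun α : Fin d → ℕ => ‖∫ x, F α x * mderiv α φ x‖) ∧
            f φ = ∑' α : Fin d → ℕ, (-1 : ℂ) ^ mOrd α * ∫ x, F α x * mderiv α φ x) ↔
      (∀ φ : Rd d → ℂ, IsTestD M φ →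
        ∃ C : ℝ, ∀ h : Rd d, ‖f (fun x => φ (x - h))‖ ≤ C * ω h)) := by
  have hM := hM1.1
  refine (fun {P Q R : Prop} (hPR : P → R) (hRQ : R → Q) (hQP : Q → P) =>
    (⟨⟨hRQ ∘ hPR, hQP⟩, ⟨hPR ∘ hQP, hRQ⟩⟩ : (P ↔ Q) ∧ (Q ↔ R))) ?_ ?_ ?_
  · rintro ⟨ℓ, hℓ, C, hC, hfC⟩ φ hφ
    obtain ⟨B, hB⟩ := hφ.exists_DL1norm_translate_le hM hω hℓ
    refine ⟨C * B, fun h => (hfC _ (hφ.translate hM h)).trans ?_⟩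
    rw [mul_assoc]
    exact mul_le_mul_of_nonneg_left (hB h) hC.le
  · intro hb
    obtain ⟨F, hFc, ℓ, hℓ, C, hC, hF, hsum⟩ := exists_structure hM1 hM2' hM3' hω hf hb
    exact ⟨F, hFc, ℓ, hℓ, C, hC, hF, fun φ hφ =>
      ⟨fun α => integrable_mul_mderiv (hFc α) hφ.smooth hφ.2.1 α,
        Summable.of_nonneg_of_le (fun _ => norm_nonneg _)
          (fun _ => norm_integral_le_integral_norm _)
          (summable_integral_norm_mul_mderiv hM hω hℓ hC hF hφ), (hsum φ hφ).tsum_eq.symm⟩⟩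
  · rintro ⟨F, hFc, ℓ, hℓ, C, hC, hF, hrep⟩
    have h0 : 0 ≤ ∑' α : Fin d → ℕ, (1 / 2 : ℝ) ^ mOrd α := tsum_nonneg fun _ => by positivity
    refine ⟨1 / (2 * ℓ), by positivity, C * (∑' α : Fin d → ℕ, (1 / 2 : ℝ) ^ mOrd α + 1),
      by positivity, fun φ hφ => ?_⟩
    rw [(hrep φ hφ).2.2]
    exact norm_le_DL1norm_of_structure hM hω hFc hℓ hC hF hφ
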